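/- Let X be a local dendrite and f : X → X a homeomorphism. Then the polynomial entropy h_pol(f) is either 0 or 1, and moreover h_pol(f) = 1 if and only if f possesses a wandering point. -/

import Mathlib

open Filter Topology TopologicalSpace Set
open scoped ENNReal NNReal

variable {X : Type*}

/-- The dynamical (Bowen) distance `d_n^f(x,y) = max_{0 ≤ k ≤ n-1} d(f^k x, f^k y)`. -/
noncomputable def dynDist [PseudoMetricSpace X] (f : X → X) (n : ℕ) (x y : X) : ℝ :=
  (((Finset.range n).sup fun k => nndist (f^[k] x) (f^[k] y) : ℝ≥0) : ℝ)

/-- `E` is `(n, ε)`-separated for `f`: distinct points of `E` are at `d_n^f`-distance `≥ ε`. -/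
def IsDynSeparated [PseudoMetricSpace X] (f : X → X) (n : ℕ) (ε : ℝ) (E : Set X) : Prop :=
  ∀ x ∈ E, ∀ y ∈ E, x ≠ y → ε ≤ dynDist f n x y

/-- `sep(n, ε)`: the maximal cardinality of a finite `(n, ε)`-separated set. -/
noncomputable def sepCount [PseudoMetricSpace X] (f : X → X) (n : ℕ) (ε : ℝ) : ℕ∞ :=
  ⨆ (E : Finset X) (_ : IsDynSeparated f n ε (E : Set X)), (E.card : ℕ∞)

/-- `limsup_{n → ∞} log (u n) / log n`, valued in `[0, ∞]`. -/
noncomputable def polGrowth (u : ℕ → ℕ∞) : ℝ≥0∞ :=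
  Filter.atTop.limsup fun n =>
    if u n = ⊤ then ⊤ else ENNReal.ofReal (Real.log ((u n).toNat : ℝ) / Real.log n)

/-- Polynomial entropy: `lim_{ε → 0⁺} limsup_{n → ∞} log sep(n,ε) / log n`; since the inner
quantity is antitone in `ε`, the limit as `ε → 0⁺` equals the supremum over `ε > 0`. -/
noncomputable def hpol [PseudoMetricSpace X] (f : X → X) : ℝ≥0∞ :=
  ⨆ (ε : ℝ) (_ : 0 < ε), polGrowth fun n => sepCount f n ε

/-- A wandering point: some open neighbourhood `U` of `p` satisfies `f^n(U) ∩ U = ∅` for all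
`n ≥ 1`. -/
def IsWanderingPoint [TopologicalSpace X] (f : X → X) (p : X) : Prop :=
  ∃ U : Set X, IsOpen U ∧ p ∈ U ∧ ∀ n : ℕ, 1 ≤ n → f^[n] '' U ∩ U = ∅

/-- A subset `D` is a dendrite: a nonempty compact connected, locally connected subspace
containing no subspace homeomorphic to the circle. -/
def IsDendriteSet [TopologicalSpace X] (D : Set X) : Prop :=
  IsCompact D ∧ IsConnected D ∧ LocallyConnectedSpace D ∧
    ¬ ∃ S : Set D, Nonempty (S ≃ₜ (Metric.sphere (0 : ℂ) 1))

/-- A local dendrite: every point has a neighbourhood which is a dendrite. (The requirement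
that `X` be a continuum is imposed via instance arguments.) -/
def IsLocalDendrite (X : Type*) [TopologicalSpace X] : Prop :=
  ∀ x : X, ∃ D : Set X, D ∈ nhds x ∧ IsDendriteSet D

/-- A compact locally connected metric space is uniformly locally connected. -/
theorem exists_delta_isPreconnected {X : Type*} [MetricSpace X] [CompactSpace X]
    [LocallyConnectedSpace X] {ε : ℝ} (hε : 0 < ε) :
    ∃ δ > 0, ∀ x y : X, dist x y < δ →
      ∃ C : Set X, IsOpen C ∧ IsPreconnected C ∧ x ∈ C ∧ y ∈ C ∧ C ⊆ Metric.ball x ε := by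
  obtain ⟨δ, hδ, h⟩ := lebesgue_number_lemma_of_metric (s := (univ : Set X))
    (c := fun z : X => connectedComponentIn (Metric.ball z (ε / 2)) z) isCompact_univ
    (fun z => Metric.isOpen_ball.connectedComponentIn)
    (fun z _ => mem_iUnion.2 ⟨z, mem_connectedComponentIn (Metric.mem_ball_self (half_pos hε))⟩)
  refine ⟨δ, hδ, fun x y hxy => ?_⟩
  obtain ⟨z, hz⟩ := h x (mem_univ x)
  have hx : x ∈ connectedComponentIn (Metric.ball z (ε / 2)) z := hz (Metric.mem_ball_self hδ)
  refine ⟨_, Metric.isOpen_ball.connectedComponentIn, isPreconnected_connectedComponentIn, hx,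
    hz (by rwa [Metric.mem_ball, dist_comm]), fun w hw => ?_⟩
  have h1 := connectedComponentIn_subset _ _ hx
  have h2 := connectedComponentIn_subset _ _ hw
  rw [Metric.mem_ball] at *
  linarith [dist_triangle_right w x z]

/-- Two points of a preconnected set are joined by chains with arbitrarily small steps. -/
theorem IsPreconnected.exists_chain {X : Type*} [MetricSpace X] {C : Set X}
    (hC : IsPreconnected C) {δ : ℝ} (hδ : 0 < δ) {x y : X} (hx : x ∈ C) (hy : y ∈ C) :
    ∃ (n : ℕ) (c : ℕ → X), c 0 = x ∧ (∀ k, n ≤ k → c k = y) ∧ (∀ k, c k ∈ C) ∧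
      ∀ k, dist (c k) (c (k + 1)) < δ := by
  set P : X → Prop := fun y => ∃ (n : ℕ) (c : ℕ → X), c 0 = x ∧ (∀ k, n ≤ k → c k = y) ∧
    (∀ k, c k ∈ C) ∧ ∀ k, dist (c k) (c (k + 1)) < δ with hP
  have step : ∀ u v, P u → v ∈ C → dist u v < δ → P v := by
    rintro u v ⟨n, c, h0, hn, hc, hd⟩ hv huv
    refine ⟨n + 1, fun k => if k ≤ n then c k else v, by simp [h0], fun k hk => ?_, fun k => ?_,
      fun k => ?_⟩
    · simp [show ¬ k ≤ n by omega]
    · dsimp only; split_ifs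
      exacts [hc k, hv]
    · dsimp only
      rcases lt_trichotomy k n with h | h | h
      · simpa [show k ≤ n by omega, show k + 1 ≤ n by omega] using hd k
      · subst h
        simpa [hn k le_rfl] using huv
      · simpa [show ¬ k ≤ n by omega, show ¬ k + 1 ≤ n by omega] using hδ
  have hPx : P x := ⟨0, fun _ => x, rfl, fun _ _ => rfl, fun _ => hx, fun _ => by simpa using hδ⟩
  by_contra hyP
  obtain ⟨w, hw, hw1, hw2⟩ := hC (⋃ u ∈ {u | u ∈ C ∧ P u}, Metric.ball u δ)
    (⋃ u ∈ {u | u ∈ C ∧ ¬ P u}, Metric.ball u δ)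
    (isOpen_biUnion fun _ _ => Metric.isOpen_ball) (isOpen_biUnion fun _ _ => Metric.isOpen_ball)
    (fun u hu => by
      by_cases h : P u
      · exact Or.inl (mem_biUnion (show u ∈ {u | u ∈ C ∧ P u} from ⟨hu, h⟩)
          (Metric.mem_ball_self hδ))
      · exact Or.inr (mem_biUnion (show u ∈ {u | u ∈ C ∧ ¬ P u} from ⟨hu, h⟩)
          (Metric.mem_ball_self hδ)))
    ⟨x, hx, mem_biUnion (show x ∈ {u | u ∈ C ∧ P u} from ⟨hx, hPx⟩) (Metric.mem_ball_self hδ)⟩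
    ⟨y, hy, mem_biUnion (show y ∈ {u | u ∈ C ∧ ¬ P u} from ⟨hy, hyP⟩) (Metric.mem_ball_self hδ)⟩
  simp only [mem_iUnion, mem_ofPred_eq, Metric.mem_ball, exists_prop] at hw1 hw2
  obtain ⟨u, ⟨hu, hPu⟩, huw⟩ := hw1
  obtain ⟨v, ⟨hv, hPv⟩, hvw⟩ := hw2
  exact hPv (step w v (step u w hPu hw (by rwa [dist_comm])) hv hvw)

/-- Refining a finite chain: every step of size `< δ` is replaced by the same number of steps of
size `< δ'`, without leaving the `ε`-ball of the starting point of the step. -/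
theorem exists_chain_refinement {X : Type*} [MetricSpace X] {δ δ' ε : ℝ} (hδ' : 0 < δ')
    (hδ : ∀ x y : X, dist x y < δ →
      ∃ C : Set X, IsOpen C ∧ IsPreconnected C ∧ x ∈ C ∧ y ∈ C ∧ C ⊆ Metric.ball x ε)
    (x : ℕ → X) (N : ℕ) (hx : ∀ i < N, dist (x i) (x (i + 1)) < δ) :
    ∃ (M : ℕ) (x' : ℕ → X), 0 < M ∧ x' 0 = x 0 ∧ x' (N * M) = x N ∧
      (∀ j < N * M, dist (x' j) (x' (j + 1)) < δ') ∧
      ∀ j < N * M, dist (x' j) (x (j / M)) < ε := by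
  have h : ∀ i, ∃ (n : ℕ) (c : ℕ → X), c 0 = x i ∧ (i < N → ((∀ k, n ≤ k → c k = x (i + 1)) ∧
      (∀ k, dist (c k) (x i) < ε) ∧ ∀ k, dist (c k) (c (k + 1)) < δ')) := by
    intro i
    by_cases hi : i < N
    · obtain ⟨C, -, hC, h1, h2, h3⟩ := hδ _ _ (hx i hi)
      obtain ⟨n, c, h0, hn, hc, hd⟩ := hC.exists_chain hδ' h1 h2
      exact ⟨n, c, h0, fun _ => ⟨hn, fun k => h3 (hc k), hd⟩⟩
    · exact ⟨0, fun _ => x i, rfl, fun h => absurd h hi⟩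
  choose n c h0 h using h
  set M := (Finset.range N).sup n + 1 with hM
  have hMn : ∀ i < N, n i ≤ M := fun i hi =>
    (Finset.le_sup (f := n) (Finset.mem_range.2 hi)).trans (Nat.le_succ _)
  have hM0 : 0 < M := Nat.succ_pos _
  refine ⟨M, fun j => c (j / M) (j % M), hM0, by simp [h0], by simp [h0], fun j hj => ?_,
    fun j hj => ?_⟩
  · have hi : j / M < N := Nat.div_lt_of_lt_mul (by rwa [mul_comm])
    obtain ⟨h1, h2, h3⟩ := h _ hi
    dsimp only
    by_cases hr : j % M + 1 < M
    · have e1 : (j + 1) / M = j / M := by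
        rw [Nat.div_eq_iff hM0]
        have := Nat.div_add_mod j M
        have e : j / M * M = M * (j / M) := mul_comm _ _
        constructor <;> omega
      have e2 : (j + 1) % M = j % M + 1 := by
        have a1 := Nat.div_add_mod j M
        have a2 := Nat.div_add_mod (j + 1) M
        rw [e1] at a2
        omega
      rw [e1, e2]
      exact h3 _
    · have hlt := Nat.mod_lt j hM0
      have hr' : j % M + 1 = M := by omega
      have e : j + 1 = M * (j / M + 1) := by
        have a1 := Nat.div_add_mod j M
        rw [mul_add]; omega
      have e1 : (j + 1) / M = j / M + 1 := by rw [e, Nat.mul_div_cancel_left _ hM0]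
      have e2 : (j + 1) % M = 0 := by rw [e, Nat.mul_mod_right]
      rw [e1, e2, h0, ← h1 (j % M + 1) (by rw [hr']; exact hMn _ hi)]
      exact h3 _
  · exact (h _ (Nat.div_lt_of_lt_mul (by rwa [mul_comm]))).2.1 _

theorem exists_delta_joinedIn {X : Type*} [MetricSpace X] [CompactSpace X]
    [LocallyConnectedSpace X] {ε : ℝ} (hε : 0 < ε) :
    ∃ δ > 0, ∀ a b : X, dist a b < δ → JoinedIn (Metric.ball a ε) a b := by
  set C : ℝ := ε / 4 with hC
  have hC0 : 0 < C := by positivity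
  have hmod : ∀ k : ℕ, ∃ δ > 0, δ ≤ C / 2 ^ k ∧ ∀ x y : X, dist x y < δ →
      ∃ S : Set X, IsOpen S ∧ IsPreconnected S ∧ x ∈ S ∧ y ∈ S ∧
        S ⊆ Metric.ball x (C / 2 / 2 ^ k) := by
    intro k
    obtain ⟨δ, hδ, h⟩ := exists_delta_isPreconnected (X := X) (ε := C / 2 / 2 ^ k) (by positivity)
    exact ⟨min δ (C / 2 ^ k), by positivity, min_le_right _ _,
      fun x y hxy => h x y (hxy.trans_le (min_le_left _ _))⟩
  choose δ hδ0 hδC hδ using hmod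
  refine ⟨δ 0, hδ0 0, fun a b hab => ?_⟩
  let State : ℕ → Type _ := fun k => {s : (ℕ → X) × ℕ // 0 < s.2 ∧ s.1 0 = a ∧ s.1 s.2 = b ∧
    ∀ i < s.2, dist (s.1 i) (s.1 (i + 1)) < δ k}
  have hstep : ∀ k (s : State k), ∃ s' : State (k + 1), ∃ M : ℕ, 0 < M ∧ s'.1.2 = s.1.2 * M ∧
      ∀ j < s.1.2 * M, dist (s'.1.1 j) (s.1.1 (j / M)) < C / 2 / 2 ^ k := by
    rintro k ⟨⟨x, N⟩, hN, hx0, hxN, hx⟩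
    obtain ⟨M, x', hM, h0, hN', h1, h2⟩ := exists_chain_refinement (hδ0 (k + 1)) (hδ k) x N hx
    exact ⟨⟨⟨x', N * M⟩, Nat.mul_pos hN hM, h0.trans hx0, hN'.trans hxN, h1⟩, M, hM, rfl, h2⟩
  choose next M hM hN hnext using hstep
  let s0 : State 0 := ⟨⟨fun i => if i = 0 then a else b, 1⟩, by simp, by simp, by simp,
    fun i hi => by
      have : i = 0 := by simpa using hi
      simpa [this] using hab⟩
  let s : ∀ k, State k := fun k => Nat.rec s0 (fun k s => next k s) k
  have hs : ∀ k, s (k + 1) = next k (s k) := fun k => rfl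
  let g : ℕ → ℝ → X := fun k t => (s k).1.1 ⌊t * (s k).1.2⌋₊
  have hNpos : ∀ k, (0 : ℝ) < (s k).1.2 := fun k => by exact_mod_cast (s k).2.1
  have hg1 : ∀ k, g k 1 = b := fun k => by simp [g, (s k).2.2.2.1]
  have hg0 : ∀ k, g k 0 = a := fun k => by simp [g, (s k).2.2.1]
  have hgd : ∀ t ∈ Icc (0 : ℝ) 1, ∀ k, dist (g k t) (g (k + 1) t) ≤ C / 2 / 2 ^ k := by
    intro t ht k
    rcases eq_or_lt_of_le ht.2 with rfl | ht1
    · rw [hg1 k, hg1 (k + 1), dist_self]; positivity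
    · have hfl : ⌊t * (s (k + 1)).1.2⌋₊ / M k (s k) = ⌊t * (s k).1.2⌋₊ := by
        rw [← Nat.floor_div_natCast]
        congr 1
        rw [hs, hN]
        have : (0 : ℝ) < M k (s k) := by exact_mod_cast hM k (s k)
        push_cast
        field_simp
      have hlt : ⌊t * (s (k + 1)).1.2⌋₊ < (s k).1.2 * M k (s k) := by
        have h0 : 0 ≤ t * ((s (k + 1)).1.2 : ℝ) := mul_nonneg ht.1 (hNpos (k + 1)).le
        rw [← hN, ← hs, Nat.floor_lt h0]
        have := hNpos (k + 1)
        nlinarith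
      have := hnext k (s k) _ hlt
      rw [hfl, ← hs] at this
      rw [dist_comm]
      exact this.le
  have hlim : ∀ t, ∃ y, t ∈ Icc (0 : ℝ) 1 → Tendsto (fun k => g k t) atTop (𝓝 y) := by
    intro t
    by_cases ht : t ∈ Icc (0 : ℝ) 1
    · obtain ⟨y, hy⟩ := cauchySeq_tendsto_of_complete
        (cauchySeq_of_le_geometric_two (hgd t ht))
      exact ⟨y, fun _ => hy⟩
    · exact ⟨a, fun h => absurd h ht⟩
  choose γ hγ using hlim
  have hγd : ∀ t ∈ Icc (0 : ℝ) 1, ∀ k, dist (g k t) (γ t) ≤ C / 2 ^ k := fun t ht k =>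
    dist_le_of_le_geometric_two_of_tendsto (hgd t ht) (hγ t ht) k
  have hcont : ContinuousOn γ (Icc 0 1) := by
    rw [Metric.continuousOn_iff]
    intro t ht η hη
    obtain ⟨k, hk⟩ : ∃ k : ℕ, 3 * (C / 2 ^ k) < η := by
      obtain ⟨k, hk⟩ := exists_pow_lt_of_lt_one (show (0 : ℝ) < η / (3 * C) by positivity)
        (show (1 / 2 : ℝ) < 1 by norm_num)
      refine ⟨k, ?_⟩
      rw [lt_div_iff₀ (by positivity), one_div, inv_pow] at hk
      calc 3 * (C / 2 ^ k) = (2 ^ k)⁻¹ * (3 * C) := by field_simp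
        _ < η := hk
    have close : ∀ u ∈ Icc (0 : ℝ) 1, ∀ v ∈ Icc (0 : ℝ) 1, u ≤ v → v - u < 1 / (s k).1.2 →
        dist (g k u) (g k v) ≤ C / 2 ^ k := by
      intro u hu v hv huv hvu
      have hN0 := hNpos k
      rw [lt_div_iff₀ hN0, sub_mul] at hvu
      have h1 : ⌊u * (s k).1.2⌋₊ ≤ ⌊v * (s k).1.2⌋₊ :=
        Nat.floor_mono (mul_le_mul_of_nonneg_right huv hN0.le)
      have h2 : ⌊v * (s k).1.2⌋₊ ≤ ⌊u * (s k).1.2⌋₊ + 1 := by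
        rw [← Nat.floor_add_one (mul_nonneg hu.1 hN0.le)]
        exact Nat.floor_mono (by linarith)
      have h3 : ⌊v * (s k).1.2⌋₊ ≤ (s k).1.2 := by
        apply Nat.floor_le_of_le
        nlinarith [hv.2]
      rcases (show ⌊v * (s k).1.2⌋₊ = ⌊u * (s k).1.2⌋₊ ∨ ⌊v * (s k).1.2⌋₊ =
        ⌊u * (s k).1.2⌋₊ + 1 by omega) with h | h
      · simp only [g, h, dist_self]; positivity
      · simp only [g, h]
        exact ((s k).2.2.2.2 _ (by omega)).le.trans (hδC k)
    refine ⟨1 / (s k).1.2, by have := hNpos k; positivity, fun u hu hut => ?_⟩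
    have h1 : dist (g k u) (g k t) ≤ C / 2 ^ k := by
      rw [Real.dist_eq] at hut
      rcases le_total u t with h | h
      · exact close u hu t ht h (by rw [abs_sub_comm] at hut; exact (le_abs_self _).trans_lt hut)
      · rw [dist_comm]
        exact close t ht u hu h ((le_abs_self _).trans_lt hut)
    have h2 := hγd u hu k
    have h3 := hγd t ht k
    calc dist (γ u) (γ t) ≤ dist (g k u) (γ u) + dist (g k u) (γ t) := dist_triangle_left _ _ _
      _ ≤ dist (g k u) (γ u) + (dist (g k u) (g k t) + dist (g k t) (γ t)) := by
        gcongr; exact dist_triangle _ _ _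
      _ < η := by linarith
  have hγ0 : γ 0 = a := tendsto_nhds_unique (hγ 0 (by simp)) (by simp [hg0])
  have hγ1 : γ 1 = b := tendsto_nhds_unique (hγ 1 (by simp)) (by simp [hg1])
  refine JoinedIn.ofLine hcont hγ0 hγ1 ?_
  rintro _ ⟨t, ht, rfl⟩
  have h1 := hγd t ht 0
  have h2 : dist (g 0 t) a ≤ C := by
    have h3 : g 0 t = a ∨ g 0 t = b := by
      show (if ⌊t * ((1 : ℕ) : ℝ)⌋₊ = 0 then a else b) = a ∨ _ = b
      by_cases h : ⌊t * ((1 : ℕ) : ℝ)⌋₊ = 0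
      · exact Or.inl (if_pos h)
      · exact Or.inr (if_neg h)
    rcases h3 with h | h
    · rw [h, dist_self]; positivity
    · rw [h, dist_comm]
      simpa using hab.le.trans (hδC 0)
  rw [Metric.mem_ball]
  have h4 := dist_triangle_left (γ t) a (g 0 t)
  simp only [pow_zero, div_one] at h1
  linarith

/-- A compact locally connected metric space is locally path connected. -/
theorem locallyPathConnectedSpace_of_compactSpace (X : Type*) [MetricSpace X] [CompactSpace X]
    [LocallyConnectedSpace X] : LocallyPathConnectedSpace X := by
  rw [locallyPathConnectedSpace_iff_pathComponentIn_mem_nhds]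
  intro x U hU hxU
  obtain ⟨ε, hε, hεU⟩ := Metric.isOpen_iff.1 hU x hxU
  obtain ⟨δ, hδ, h⟩ := exists_delta_joinedIn (X := X) hε
  refine mem_of_superset (Metric.ball_mem_nhds x hδ) fun y hy => ?_
  exact (h x y (by rwa [dist_comm])).mono hεU

/-- The closed subsets of `[0, 1]` containing the endpoints such that `γ` takes the same value at
the two ends of each complementary interval. -/
def IsGapConstant {X : Type*} (γ : ℝ → X) (A : Set ℝ) : Prop :=
  IsClosed A ∧ A ⊆ Icc 0 1 ∧ (0 : ℝ) ∈ A ∧ (1 : ℝ) ∈ A ∧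
    ∀ s ∈ A, ∀ t ∈ A, s < t → Disjoint (Ioo s t) A → γ s = γ t

theorem exists_minimal_isGapConstant {X : Type*} [MetricSpace X] {γ : ℝ → X} (hγ : Continuous γ) :
    ∃ A, Minimal (IsGapConstant γ) A := by
  refine zorn_superset {A | IsGapConstant γ A} fun c hc hchain => ?_
  rcases c.eq_empty_or_nonempty with rfl | hne
  · refine ⟨Icc 0 1, ⟨isClosed_Icc, Subset.rfl, by simp, by simp, fun s hs t ht hst hd => ?_⟩,
      by simp⟩
    exact absurd (Disjoint.notMem_of_mem_left hd (a := (s + t) / 2) ⟨by linarith, by linarith⟩)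
      (not_not.2 ⟨by linarith [hs.1, ht.1], by linarith [hs.2, ht.2]⟩)
  refine ⟨⋂₀ c, ⟨isClosed_sInter fun A hA => (hc hA).1, ?_, fun A hA => (hc hA).2.2.1,
    fun A hA => (hc hA).2.2.2.1, fun s hs t ht hst hd => ?_⟩, fun A hA => sInter_subset_of_mem hA⟩
  · obtain ⟨A, hA⟩ := hne
    exact (sInter_subset_of_mem hA).trans (hc hA).2.1
  by_contra hne'
  obtain ⟨u, hu, v, hv, huv⟩ : ∃ u ∈ 𝓝 s, ∃ v ∈ 𝓝 t, ∀ x ∈ u, ∀ y ∈ v, γ x ≠ γ y := by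
    have h : {p : ℝ × ℝ | γ p.1 ≠ γ p.2} ∈ 𝓝 (s, t) :=
      (isOpen_ne_fun (by fun_prop) (by fun_prop)).mem_nhds hne'
    obtain ⟨u, hu, v, hv, h⟩ := mem_nhds_prod_iff.1 h
    exact ⟨u, hu, v, hv, fun x hx y hy => h (mk_mem_prod hx hy)⟩
  obtain ⟨η₁, h1, hu'⟩ := Metric.mem_nhds_iff.1 hu
  obtain ⟨η₂, h2, hv'⟩ := Metric.mem_nhds_iff.1 hv
  obtain ⟨η, hη, hη1, hη2, hη3⟩ : ∃ η > 0, η < η₁ ∧ η < η₂ ∧ s + η < t - η :=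
    ⟨min (min (η₁ / 2) (η₂ / 2)) ((t - s) / 4), by
      have : 0 < t - s := by linarith
      positivity, by
      have := min_le_left (min (η₁ / 2) (η₂ / 2)) ((t - s) / 4)
      have := min_le_left (η₁ / 2) (η₂ / 2)
      linarith, by
      have := min_le_left (min (η₁ / 2) (η₂ / 2)) ((t - s) / 4)
      have := min_le_right (η₁ / 2) (η₂ / 2)
      linarith, by
      have := min_le_right (min (η₁ / 2) (η₂ / 2)) ((t - s) / 4)
      linarith⟩
  obtain ⟨A, hA, hAK⟩ : ∃ A ∈ c, Disjoint (Icc (s + η) (t - η)) A := by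
    have : Nonempty c := hne.to_subtype
    obtain ⟨⟨A, hA⟩, h⟩ := IsCompact.elim_directed_family_closed
      (isCompact_Icc (a := s + η) (b := t - η))
      (fun A : c => A.1) (fun A => (hc A.2).1) (by
        rw [← sInter_eq_iInter, ← disjoint_iff_inter_eq_empty]
        exact hd.mono_left (Icc_subset_Ioo (by linarith) (by linarith)))
      (by
        intro A B
        rcases hchain.total A.2 B.2 with h | h
        · exact ⟨A, Subset.rfl, h⟩
        · exact ⟨B, h, Subset.rfl⟩)
    exact ⟨A, hA, disjoint_iff_inter_eq_empty.2 h⟩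
  have hAc := hc hA
  obtain ⟨s', hs', hs'2⟩ := ((isCompact_Icc (a := s) (b := s + η)).inter_left hAc.1).exists_isGreatest
    ⟨s, hs A hA, by simp [hη.le]⟩
  obtain ⟨t', ht', ht'2⟩ := ((isCompact_Icc (a := t - η) (b := t)).inter_left hAc.1).exists_isLeast
    ⟨t, ht A hA, by simp [hη.le]⟩
  have h3 := hs'.2
  have h4 := ht'.2
  rw [mem_Icc] at h3 h4
  refine huv s' (hu' ?_) t' (hv' ?_) (hAc.2.2.2.2 s' hs'.1 t' ht'.1 (by linarith) ?_)
  · rw [Metric.mem_ball, Real.dist_eq, abs_lt]; constructor <;> linarith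
  · rw [Metric.mem_ball, Real.dist_eq, abs_lt]; constructor <;> linarith
  · rw [disjoint_left]
    rintro w ⟨hw1, hw2⟩ hwA
    by_cases h5 : w ≤ s + η
    · exact absurd (hs'2 ⟨hwA, by linarith, h5⟩) (not_le.2 hw1)
    by_cases h6 : t - η ≤ w
    · exact absurd (ht'2 ⟨hwA, h6, by linarith⟩) (not_le.2 hw2)
    exact Disjoint.notMem_of_mem_left hAK (a := w) ⟨by linarith, by linarith⟩ hwA

theorem Minimal.disjoint_Ioo_of_isGapConstant {X : Type*} {γ : ℝ → X} {A : Set ℝ}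
    (hA : Minimal (IsGapConstant γ) A) {s t : ℝ} (hs : s ∈ A) (ht : t ∈ A) (h : γ s = γ t) :
    Disjoint (Ioo s t) A := by
  have key : IsGapConstant γ (A \ Ioo s t) := by
    obtain ⟨h1, h2, h3, h4, h5⟩ := hA.1
    refine ⟨h1.sdiff isOpen_Ioo, sdiff_subset.trans h2, ⟨h3, fun h' => ?_⟩, ⟨h4, fun h' => ?_⟩,
      fun u hu v hv huv hd => ?_⟩
    · linarith [h'.1, (h2 hs).1]
    · linarith [h'.2, (h2 ht).2]
    · by_cases hd' : Disjoint (Ioo u v) A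
      · exact h5 u hu.1 v hv.1 huv hd'
      obtain ⟨w, hw, hwA⟩ := not_disjoint_iff.1 hd'
      have hwst : w ∈ Ioo s t := by
        by_contra h'
        exact disjoint_left.1 hd hw ⟨hwA, h'⟩
      have hsu : s ≤ u := by
        by_contra! h'
        exact Disjoint.notMem_of_mem_left hd (a := s) ⟨h', hwst.1.trans hw.2⟩ ⟨hs, fun h => lt_irrefl _ h.1⟩
      have htv : v ≤ t := by
        by_contra! h'
        exact Disjoint.notMem_of_mem_left hd (a := t) ⟨hw.1.trans hwst.2, h'⟩ ⟨ht, fun h => lt_irrefl _ h.2⟩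
      have hus : u = s := by
        by_contra h'
        exact hu.2 ⟨lt_of_le_of_ne hsu (Ne.symm h'), hw.1.trans hwst.2⟩
      have hvt : v = t := by
        by_contra h'
        exact hv.2 ⟨hwst.1.trans hw.2, lt_of_le_of_ne htv h'⟩
      rw [hus, hvt, h]
  rw [disjoint_left]
  exact fun w hw hwA => (hA.2 key sdiff_subset hwA).2 hw

/-- The largest distance to `γ q` attained by `γ` on `A ∩ [q, t]`. -/
noncomputable def gapVariation {X : Type*} [MetricSpace X] (γ : ℝ → X) (A : Set ℝ) (q t : ℝ) : ℝ :=
  sSup ((fun s => dist (γ s) (γ q)) '' (A ∩ Icc q t))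

section gapVariation
variable {X : Type*} [MetricSpace X] {γ : ℝ → X} {A : Set ℝ} {D : ℝ}

theorem gapVariation_nonneg {q t : ℝ} : 0 ≤ gapVariation γ A q t :=
  Real.sSup_nonneg (by rintro _ ⟨s, -, rfl⟩; exact dist_nonneg)

theorem le_gapVariation (hD : ∀ x y : X, dist x y ≤ D) {q s t : ℝ} (hs : s ∈ A) (hqs : q ≤ s)
    (hst : s ≤ t) : dist (γ s) (γ q) ≤ gapVariation γ A q t :=
  le_csSup ⟨D, by rintro _ ⟨s, -, rfl⟩; exact hD _ _⟩ ⟨s, ⟨hs, hqs, hst⟩, rfl⟩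

theorem gapVariation_le (hD : ∀ x y : X, dist x y ≤ D) (hD0 : 0 ≤ D) {q t : ℝ} :
    gapVariation γ A q t ≤ D :=
  Real.sSup_le (by rintro _ ⟨s, -, rfl⟩; exact hD _ _) hD0

theorem gapVariation_eq_zero {q t : ℝ} (h : t ≤ q) : gapVariation γ A q t = 0 := by
  refine le_antisymm (Real.sSup_le ?_ le_rfl) gapVariation_nonneg
  rintro _ ⟨s, ⟨-, h1, h2⟩, rfl⟩
  rw [show s = q by linarith]
  simp

theorem gapVariation_mono (hD : ∀ x y : X, dist x y ≤ D) {q : ℝ} :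
    Monotone (gapVariation γ A q) := by
  intro s t hst
  refine Real.sSup_le ?_ gapVariation_nonneg
  rintro _ ⟨u, ⟨hu, h1, h2⟩, rfl⟩
  exact le_gapVariation hD hu h1 (h2.trans hst)

theorem gapVariation_le_add (hD : ∀ x y : X, dist x y ≤ D) {q s t e : ℝ} (he : 0 ≤ e) (hs : s ∈ A)
    (hq : q ∈ A) (h : ∀ u ∈ A, s ≤ u → u ≤ t → dist (γ u) (γ s) ≤ e) :
    gapVariation γ A q t ≤ gapVariation γ A q s + 2 * e := by
  have h0 := gapVariation_nonneg (γ := γ) (A := A) (q := q) (t := s)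
  refine Real.sSup_le ?_ (by positivity)
  rintro _ ⟨u, ⟨hu, h1, h2⟩, rfl⟩
  dsimp only
  rcases le_total u s with hus | hsu
  · linarith [le_gapVariation (γ := γ) hD hu h1 hus]
  have h3 := h u hu hsu h2
  rcases le_total q s with hqs | hsq
  · linarith [le_gapVariation (γ := γ) hD hs hqs le_rfl, dist_triangle (γ u) (γ s) (γ q)]
  · linarith [h q hq hsq (h1.trans h2), dist_triangle_right (γ u) (γ q) (γ s)]

end gapVariation

/-- Any two distinct points joined by a path are joined by an injective path. -/
theorem exists_injective_path {X : Type*} [MetricSpace X] [CompactSpace X] {a b : X} (hab : a ≠ b)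
    (p : Path a b) : ∃ q : Path a b, Function.Injective q ∧ range q ⊆ range p := by
  set γ : ℝ → X := ⇑p.extend with hγdef
  have hγ : Continuous γ := p.continuous_extend
  have hγ0 : γ 0 = a := p.extend_zero
  have hγ1 : γ 1 = b := p.extend_one
  obtain ⟨A, hA⟩ := exists_minimal_isGapConstant hγ
  obtain ⟨hAc, hAI, hA0, hA1, hAg⟩ := hA.1
  have hAK : IsCompact A := isCompact_Icc.of_isClosed_subset hAc hAI
  have : Nonempty A := ⟨⟨0, hA0⟩⟩
  obtain ⟨D, hD⟩ : ∃ D, ∀ x y : X, dist x y ≤ D :=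
    ⟨Metric.diam (univ : Set X), fun x y =>
      Metric.dist_le_diam_of_mem isCompact_univ.isBounded (mem_univ x) (mem_univ y)⟩
  have hD0 : 0 ≤ D := dist_nonneg.trans (hD a a)
  let q : ℕ → ℝ := fun n => (denseSeq A n : ℝ)
  have hqA : ∀ n, q n ∈ A := fun n => (denseSeq A n).2
  have hqd : ∀ s t : ℝ, (Ioo s t ∩ A).Nonempty → ∃ n, q n ∈ Ioo s t := by
    rintro s t ⟨w, hw, hwA⟩
    obtain ⟨n, hn⟩ := (denseRange_denseSeq A).exists_mem_open
      (isOpen_Ioo.preimage continuous_subtype_val : IsOpen ((↑) ⁻¹' Ioo s t : Set A)) ⟨⟨w, hwA⟩, hw⟩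
    exact ⟨n, hn⟩
  have hsum : ∀ t, Summable fun n => (1 / 2 : ℝ) ^ n * gapVariation γ A (q n) t := fun t =>
    Summable.of_nonneg_of_le (fun n => mul_nonneg (by positivity) gapVariation_nonneg)
      (fun n => mul_le_mul_of_nonneg_left (gapVariation_le hD hD0) (by positivity))
      (summable_geometric_two.mul_right D)
  set h : ℝ → ℝ := fun t => ∑' n, (1 / 2 : ℝ) ^ n * gapVariation γ A (q n) t with hh
  have hmono : Monotone h := fun s t hst => (hsum s).tsum_le_tsum
    (fun n => mul_le_mul_of_nonneg_left (gapVariation_mono hD hst) (by positivity)) (hsum t)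
  have hmod : ∀ s ∈ A, ∀ t e : ℝ, 0 ≤ e → (∀ u ∈ A, s ≤ u → u ≤ t → dist (γ u) (γ s) ≤ e) →
      h t ≤ h s + 4 * e := by
    intro s hs t e he hu
    calc h t ≤ ∑' n, ((1 / 2 : ℝ) ^ n * gapVariation γ A (q n) s + (1 / 2 : ℝ) ^ n * (2 * e)) :=
          (hsum t).tsum_le_tsum (fun n => by
            rw [← mul_add]
            exact mul_le_mul_of_nonneg_left (gapVariation_le_add hD he hs (hqA n) hu)
              (by positivity)) ((hsum s).add (summable_geometric_two.mul_right _))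
      _ = h s + 4 * e := by
        rw [(hsum s).tsum_add (summable_geometric_two.mul_right _), tsum_mul_right,
          tsum_geometric_two]
        ring
  have heq : ∀ s ∈ A, ∀ t ∈ A, s ≤ t → γ s = γ t → h s = h t := by
    intro s hs t ht hst hst'
    refine le_antisymm (hmono hst) ?_
    have := hmod s hs t 0 le_rfl fun u hu hsu hut => by
      have hd := Disjoint.notMem_of_mem_left (hA.disjoint_Ioo_of_isGapConstant hs ht hst') (a := u)
      rcases hsu.eq_or_lt with rfl | h1
      · simp
      rcases hut.eq_or_lt with rfl | h2
      · simp [hst']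
      exact absurd hu (hd ⟨h1, h2⟩)
    simpa using this
  have hinj : ∀ s ∈ A, ∀ t ∈ A, s ≤ t → h s = h t → γ s = γ t := by
    intro s hs t ht hst hst'
    by_contra hne
    have hlt : s < t := lt_of_le_of_ne hst (by rintro rfl; exact hne rfl)
    have hq : ∀ n, q n ∈ Ioo s t → γ (q n) = γ t := by
      intro n hn
      have h1 : gapVariation γ A (q n) t ≤ 0 := by
        by_contra! hpos
        refine absurd hst' (ne_of_lt ((hsum s).tsum_lt_tsum (i := n) (fun m =>
          mul_le_mul_of_nonneg_left (gapVariation_mono hD hst) (by positivity)) ?_ (hsum t)))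
        rw [gapVariation_eq_zero hn.1.le, mul_zero]
        positivity
      have h2 := (le_gapVariation (γ := γ) hD ht hn.2.le le_rfl).trans h1
      exact (dist_le_zero.1 h2).symm
    obtain ⟨w, hw⟩ := not_disjoint_iff_nonempty_inter.1 (fun hd => hne (hAg s hs t ht hlt hd))
    obtain ⟨n, hn⟩ := hqd s t ⟨w, hw⟩
    have h1 := hq n hn
    refine hne ((hAg s hs (q n) (hqA n) hn.1 ?_).trans h1)
    rw [disjoint_left]
    intro u hu huA
    obtain ⟨m, hm⟩ := hqd s (q n) ⟨u, hu, huA⟩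
    exact disjoint_left.1 (hA.disjoint_Ioo_of_isGapConstant (hqA m) ht
      (hq m ⟨hm.1, hm.2.trans hn.2⟩)) ⟨hm.2, hn.2⟩ (hqA n)
  have hcont : ContinuousOn h A := by
    rw [Metric.continuousOn_iff]
    intro s hs e he
    obtain ⟨δ, hδ, hu⟩ := Metric.uniformContinuousOn_iff.1
      (hAK.uniformContinuousOn_of_continuous hγ.continuousOn) (e / 8) (by positivity)
    have close : ∀ s ∈ A, ∀ t ∈ A, s ≤ t → t - s < δ → h t - h s < e := by
      intro s hs t ht hst hts
      have := hmod s hs t (e / 8) (by positivity) fun u huA h1 h2 =>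
        (hu u huA s hs (by rw [Real.dist_eq, abs_of_nonneg] <;> linarith)).le
      linarith
    refine ⟨δ, hδ, fun t ht hts => ?_⟩
    rw [Real.dist_eq] at *
    rcases le_total s t with hst | hst
    · rw [abs_of_nonneg (by linarith [hmono hst])]
      exact close s hs t ht hst ((le_abs_self _).trans_lt hts)
    · rw [abs_sub_comm] at *
      rw [abs_of_nonneg (by linarith [hmono hst])]
      exact close t ht s hs hst ((le_abs_self _).trans_lt hts)
  have hh0 : h 0 = 0 := by
    have h0 : ∀ n, (1 / 2 : ℝ) ^ n * gapVariation γ A (q n) 0 = 0 := fun n => by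
      rw [gapVariation_eq_zero (hAI (hqA n)).1, mul_zero]
    simp only [hh, h0, tsum_zero]
  have hH : 0 < h 1 := by
    rw [← hh0]
    refine lt_of_le_of_ne (hmono zero_le_one) fun h' => hab ?_
    rw [← hγ0, ← hγ1]
    exact hinj 0 hA0 1 hA1 zero_le_one h'
  let k : A → unitInterval := fun s => ⟨h s / h 1, div_nonneg (hh0 ▸ hmono (hAI s.2).1) hH.le,
    (div_le_one hH).2 (hmono (hAI s.2).2)⟩
  have hk : ∀ s t : A, k s = k t ↔ h s = h t := fun s t => by
    exact Subtype.ext_iff.trans (div_left_inj' hH.ne')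
  have hkc : Continuous k := by
    have := continuousOn_iff_continuous_domRestrict.1 hcont
    exact Continuous.subtype_mk (this.div_const _) _
  have hks : Function.Surjective k := by
    rintro ⟨v, hv0, hv1⟩
    have hKle : IsCompact (A ∩ h ⁻¹' Iic (v * h 1)) :=
      hAK.of_isClosed_subset (hcont.preimage_isClosed_of_isClosed hAc isClosed_Iic) inter_subset_left
    have hKge : IsCompact (A ∩ h ⁻¹' Ici (v * h 1)) :=
      hAK.of_isClosed_subset (hcont.preimage_isClosed_of_isClosed hAc isClosed_Ici) inter_subset_left
    obtain ⟨s, ⟨hs, hsv⟩, hs'⟩ := hKle.exists_isGreatest ⟨0, hA0, by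
      show h 0 ≤ _
      rw [hh0]; positivity⟩
    obtain ⟨t, ⟨ht, htv⟩, ht'⟩ := hKge.exists_isLeast ⟨1, hA1, by
      show _ ≤ h 1
      nlinarith⟩
    have hsv' : h s ≤ v * h 1 := hsv
    have htv' : v * h 1 ≤ h t := htv
    have hst : h s = v * h 1 := by
      by_contra hne
      have h1 : h s < h t := (lt_of_le_of_ne hsv' hne).trans_le htv'
      have h2 : s < t := by
        by_contra! h'
        exact absurd (hmono h') (not_le.2 h1)
      refine h1.ne (heq s hs t ht h2.le (hAg s hs t ht h2 ?_))
      rw [disjoint_left]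
      intro u hu huA
      rcases le_total (h u) (v * h 1) with h3 | h3
      · exact absurd (hs' ⟨huA, h3⟩) (not_le.2 hu.1)
      · exact absurd (ht' ⟨huA, h3⟩) (not_le.2 hu.2)
    refine ⟨⟨s, hs⟩, Subtype.ext ?_⟩
    show h s / h 1 = v
    rw [hst, mul_div_cancel_right₀ _ hH.ne']
  have hγk : ∀ s t : A, k s = k t ↔ γ s = γ t := by
    intro s t
    rw [hk]
    rcases le_total s.1 t.1 with hst | hst
    · exact ⟨hinj _ s.2 _ t.2 hst, heq _ s.2 _ t.2 hst⟩
    · exact ⟨fun e => (hinj _ t.2 _ s.2 hst e.symm).symm, fun e => (heq _ t.2 _ s.2 hst e.symm).symm⟩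
  have : CompactSpace A := isCompact_iff_compactSpace.1 hAK
  let σ : unitInterval → A := Function.surjInv hks
  have hσ : ∀ v, k (σ v) = v := Function.surjInv_eq hks
  have hσk : ∀ s : A, γ (σ (k s)) = γ s := fun s => (hγk _ _).1 (hσ _)
  have hαc : Continuous fun v => γ (σ v) := by
    rw [(hkc.isClosedMap.isQuotientMap hkc hks).continuous_iff]
    have : (fun v => γ (σ v)) ∘ k = fun s : A => γ s := funext hσk
    rw [this]
    exact hγ.comp continuous_subtype_val
  have hk0 : k ⟨0, hA0⟩ = 0 := Subtype.ext (by simp [k, hh0])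
  have hk1 : k ⟨1, hA1⟩ = 1 := Subtype.ext (by simp [k, hH.ne'])
  refine ⟨⟨⟨fun v => γ (σ v), hαc⟩, ?_, ?_⟩, fun v w hvw => ?_, ?_⟩
  · show γ (σ 0) = a
    rw [← hk0, hσk, hγ0]
  · show γ (σ 1) = b
    rw [← hk1, hσk, hγ1]
  · rw [← hσ v, ← hσ w]
    exact (hγk _ _).2 hvw
  · rintro _ ⟨v, rfl⟩
    rw [← p.extend_range]
    exact ⟨_, rfl⟩

theorem Path.extend_injOn {X : Type*} [TopologicalSpace X] {a b : X} {p : Path a b}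
    (hp : Function.Injective p) : InjOn p.extend (Icc 0 1) := by
  intro x hx y hy h
  rw [Path.extend_apply _ hx, Path.extend_apply _ hy] at h
  exact congrArg Subtype.val (hp h)

/-- Two injective paths in opposite directions which meet only at their endpoints form a circle. -/
theorem exists_homeomorph_circle {X : Type*} [TopologicalSpace X] [T2Space X] {u v : X}
    {p : Path u v} {q : Path v u} (hp : Function.Injective p) (hq : Function.Injective q)
    (h : ∀ x ∈ range p, x ∈ range q → x = u ∨ x = v) :
    ∃ S : Set X, Nonempty (S ≃ₜ (Metric.sphere (0 : ℂ) 1)) := by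
  have : Fact ((0 : ℝ) < 1) := ⟨one_pos⟩
  set F : ℝ → X := ⇑(p.trans q).extend with hF
  have hinj : InjOn F (Ico 0 1) := by
    have key : ∀ x ∈ Ico (0 : ℝ) 1, ∀ y ∈ Ico (0 : ℝ) 1, x ≤ y → F x = F y → x = y := by
      intro x hx y hy hxy he
      rcases le_total y (1 / 2) with h1 | h1
      · rw [hF, Path.extend_trans_of_le_half _ _ h1, Path.extend_trans_of_le_half _ _ (hxy.trans h1)]
          at he
        have := Path.extend_injOn hp (x₁ := 2 * x) (x₂ := 2 * y) ⟨by linarith [hx.1], by linarith⟩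
          ⟨by linarith [hy.1], by linarith⟩ he
        linarith
      rcases le_total x (1 / 2) with h2 | h2
      · rw [hF, Path.extend_trans_of_half_le _ _ h1, Path.extend_trans_of_le_half _ _ h2] at he
        have hy' : 2 * y - 1 ∈ Icc (0 : ℝ) 1 := ⟨by linarith, by linarith [hy.2]⟩
        have e1 : p.extend (2 * x) ∈ range p := by rw [← p.extend_range]; exact ⟨_, rfl⟩
        have e2 : p.extend (2 * x) ∈ range q := by rw [← q.extend_range, he]; exact ⟨_, rfl⟩
        rcases h _ e1 e2 with h3 | h3
        · rw [he] at h3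
          have := Path.extend_injOn hq hy' (by simp : (1 : ℝ) ∈ Icc (0 : ℝ) 1)
            (by rw [h3, q.extend_one])
          linarith [hy.2]
        · have h4 := Path.extend_injOn hp (x₁ := 2 * x) ⟨by linarith [hx.1], by linarith⟩
            (by simp : (1 : ℝ) ∈ Icc (0 : ℝ) 1) (by rw [h3, p.extend_one])
          rw [he] at h3
          have := Path.extend_injOn hq hy' (by simp : (0 : ℝ) ∈ Icc (0 : ℝ) 1)
            (by rw [h3, q.extend_zero])
          linarith
      · rw [hF, Path.extend_trans_of_half_le _ _ h1, Path.extend_trans_of_half_le _ _ h2] at he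
        have := Path.extend_injOn hq ⟨by linarith, by linarith [hx.2]⟩
          ⟨by linarith, by linarith [hy.2]⟩ he
        linarith
    intro x hx y hy he
    rcases le_total x y with hxy | hxy
    · exact key x hx y hy hxy he
    · exact (key y hy x hx hxy he.symm).symm
  have hFc : Continuous F := (p.trans q).continuous_extend
  have hGc : Continuous (AddCircle.liftIco 1 0 F) :=
    AddCircle.liftIco_zero_continuous (by rw [hF, Path.extend_zero, Path.extend_one])
      hFc.continuousOn
  have hGi : Function.Injective (AddCircle.liftIco 1 0 F) := by
    intro x y hxy
    obtain ⟨x', hx', rfl⟩ := (AddCircle.coe_image_Ico_eq (1 : ℝ) 0).symm ▸ mem_univ x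
    obtain ⟨y', hy', rfl⟩ := (AddCircle.coe_image_Ico_eq (1 : ℝ) 0).symm ▸ mem_univ y
    rw [zero_add] at hx' hy'
    rw [AddCircle.liftIco_zero_coe_apply hx', AddCircle.liftIco_zero_coe_apply hy'] at hxy
    rw [hinj hx' hy' hxy]
  have hS : Circle ≃ₜ Metric.sphere (0 : ℂ) 1 :=
    { toFun := fun z => ⟨z, by simp [Circle.norm_coe z]⟩
      invFun := fun z => ⟨z, z.2⟩
      left_inv := fun z => rfl
      right_inv := fun z => rfl
      continuous_toFun := by fun_prop
      continuous_invFun := continuous_id }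
  exact ⟨_, ⟨((hGc.isClosedEmbedding hGi).isEmbedding.toHomeomorph.symm.trans
    (AddCircle.homeomorphCircle one_ne_zero)).trans hS⟩⟩

theorem Path.subpath_injective {X : Type*} [TopologicalSpace X] {a b : X} {p : Path a b}
    (hp : Function.Injective p) {s t : unitInterval} (hst : s ≠ t) :
    Function.Injective (p.subpath s t) := by
  intro x y h
  have h1 := hp h
  have h2 := congrArg Subtype.val h1
  simp only [Icc.coe_convexComb] at h2
  have h3 : (t : ℝ) - s ≠ 0 := fun h => hst (Subtype.ext (by linarith))
  exact Subtype.ext (mul_right_cancel₀ h3 (by linarith))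

/-- In a locally connected continuum without circles, any two points are separated by a third. -/
theorem exists_separating_point {N : Type*} [MetricSpace N] [CompactSpace N] [ConnectedSpace N]
    [LocallyConnectedSpace N] (hN : ¬ ∃ S : Set N, Nonempty (S ≃ₜ (Metric.sphere (0 : ℂ) 1)))
    {a b : N} (hab : a ≠ b) :
    ∃ (c : N) (P Q : Set N), IsOpen P ∧ IsOpen Q ∧ Disjoint P Q ∧ P ∪ Q = {c}ᶜ ∧ a ∈ P ∧ b ∈ Q := by
  have := locallyPathConnectedSpace_of_compactSpace N
  have hpc : PathConnectedSpace N := pathConnectedSpace_iff_connectedSpace.2 inferInstance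
  obtain ⟨p, hp, -⟩ := exists_injective_path hab (hpc.somePath a b)
  set m : unitInterval := ⟨1 / 2, by norm_num, by norm_num⟩ with hm
  have hm0 : m ≠ 0 := fun h => by simpa [hm] using congrArg Subtype.val h
  have hm1 : m ≠ 1 := fun h => by
    have := congrArg Subtype.val h
    norm_num [hm] at this
  have ha : a ∈ ({p m}ᶜ : Set N) := fun h => hm0 (hp (by rw [p.source]; exact h.symm))
  have hb : b ∈ ({p m}ᶜ : Set N) := fun h => hm1 (hp (by rw [p.target]; exact h.symm))
  set P := connectedComponentIn ({p m}ᶜ : Set N) a with hP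
  have hPo : IsOpen P := isOpen_compl_singleton.connectedComponentIn
  by_cases hbP : b ∈ P
  · exfalso
    have hPpc : IsPathConnected P := hPo.isConnected_iff_isPathConnected.1
      (isConnected_connectedComponentIn_iff.2 ha)
    obtain ⟨q₀, hq₀⟩ := hPpc.joinedIn a (mem_connectedComponentIn ha) b hbP
    obtain ⟨q, hq, hqr⟩ := exists_injective_path hab q₀
    have hqm : p m ∉ range q := fun h => by
      obtain ⟨t, ht⟩ := hqr h
      exact connectedComponentIn_subset _ _ (hq₀ t) ht
    have hK : IsClosed (p ⁻¹' range q) :=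
      (isCompact_range q.continuous).isClosed.preimage p.continuous
    obtain ⟨s, ⟨⟨s', hs'⟩, hsm⟩, hs2⟩ := (hK.inter isClosed_Iic).isCompact.exists_isGreatest
      (⟨0, ⟨0, by simp⟩, unitInterval.nonneg'⟩ : (p ⁻¹' range q ∩ Iic m).Nonempty)
    obtain ⟨t, ⟨⟨t', ht'⟩, htm⟩, ht2⟩ := (hK.inter isClosed_Ici).isCompact.exists_isLeast
      (⟨1, ⟨1, by simp⟩, unitInterval.le_one'⟩ : (p ⁻¹' range q ∩ Ici m).Nonempty)
    rw [mem_Iic] at hsm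
    rw [mem_Ici] at htm
    have hst : s ≠ t := by
      rintro rfl
      exact hqm (le_antisymm hsm htm ▸ ⟨s', hs'⟩)
    have hst' : s' ≠ t' := by
      rintro rfl
      exact hst (hp (hs'.symm.trans ht'))
    refine hN (exists_homeomorph_circle (p := p.subpath s t)
      (q := (q.subpath t' s').cast ht'.symm hs'.symm) (Path.subpath_injective hp hst)
      (Path.subpath_injective hq hst'.symm) ?_)
    rintro x hx ⟨r, hr⟩
    rw [p.range_subpath_of_le _ _ (hsm.trans htm)] at hx
    obtain ⟨w, ⟨hw1, hw2⟩, rfl⟩ := hx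
    have hwq : w ∈ p ⁻¹' range q := ⟨_, hr⟩
    rcases le_total w m with h | h
    · exact Or.inl (congrArg p (le_antisymm (hs2 ⟨hwq, h⟩) hw1))
    · exact Or.inr (congrArg p (le_antisymm hw2 (ht2 ⟨hwq, h⟩)))
  · refine ⟨p m, P, {p m}ᶜ \ P, hPo, ?_, disjoint_sdiff_right, ?_, mem_connectedComponentIn ha,
      hb, hbP⟩
    · rw [isOpen_iff_mem_nhds]
      rintro x ⟨hx, hxP⟩
      refine mem_of_superset (isOpen_compl_singleton.connectedComponentIn.mem_nhds
        (mem_connectedComponentIn hx)) fun y hy => ⟨connectedComponentIn_subset _ _ hy, fun hyP => hxP ?_⟩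
      have e1 := connectedComponentIn_eq hy
      have e2 := connectedComponentIn_eq hyP
      rw [hP, e2, ← e1]
      exact mem_connectedComponentIn hx
    · exact union_sdiff_cancel (connectedComponentIn_subset _ _)

theorem IsPreconnected.subset_of_disjoint_frontier {X : Type*} [TopologicalSpace X] {s u : Set X}
    (hs : IsPreconnected s) (hu : IsOpen u) (hsu : (s ∩ u).Nonempty)
    (hd : Disjoint s (frontier u)) : s ⊆ u :=
  hs.subset_of_closure_inter_subset hu hsu fun x hx => by
    by_contra h
    exact hd.notMem_of_mem_left hx.2 ⟨hx.1, by rwa [hu.interior_eq]⟩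

theorem IsPreconnected.inter_frontier_nonempty_of_not_subset {X : Type*} [TopologicalSpace X]
    {s u : Set X} (hs : IsPreconnected s) (hu : IsOpen u) (hsu : (s ∩ u).Nonempty)
    (h : ¬ s ⊆ u) : (s ∩ frontier u).Nonempty :=
  not_disjoint_iff_nonempty_inter.1 fun hd => h (hs.subset_of_disjoint_frontier hu hsu hd)

theorem IsLocalDendrite.locallyConnectedSpace {X : Type*} [TopologicalSpace X]
    (hX : IsLocalDendrite X) : LocallyConnectedSpace X := by
  rw [locallyConnectedSpace_iff_connected_subsets]
  intro x U hU
  obtain ⟨D, hD, -, -, hDl, -⟩ := hX x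
  obtain ⟨V, hV, hVp, hVU⟩ := locallyConnectedSpace_iff_connected_subsets.1 hDl
    ⟨x, mem_of_mem_nhds hD⟩ (Subtype.val ⁻¹' U) (continuous_subtype_val.continuousAt hU)
  refine ⟨Subtype.val '' V, ?_, hVp.image _ continuous_subtype_val.continuousOn, image_subset_iff.2 hVU⟩
  rw [← map_nhds_subtype_coe_eq_nhds (mem_of_mem_nhds hD) hD]
  exact image_mem_map hV

/-- Every point of a local dendrite has a connected neighbourhood any two points of which are
separated in it by a third point. -/
theorem IsLocalDendrite.exists_nhds_separating {X : Type*} [MetricSpace X]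
    (hX : IsLocalDendrite X) (x : X) :
    ∃ N ∈ 𝓝 x, IsPreconnected N ∧ ∀ a ∈ N, ∀ b ∈ N, a ≠ b → ∃ c ∈ N, ∃ P Q : Set X,
      IsOpen P ∧ IsOpen Q ∧ (∀ y ∈ N, y ∈ P → y ∉ Q) ∧ (∀ y ∈ N, y ∈ P ∪ Q ↔ y ≠ c) ∧ a ∈ P ∧ b ∈ Q := by
  obtain ⟨D, hD, hDk, hDc, hDl, hDn⟩ := hX x
  refine ⟨D, hD, hDc.isPreconnected, fun a ha b hb hab => ?_⟩
  have : CompactSpace D := isCompact_iff_compactSpace.1 hDk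
  have : ConnectedSpace D := isConnected_iff_connectedSpace.1 hDc
  obtain ⟨c, P, Q, hP, hQ, hPQ, hc, haP, hbQ⟩ := exists_separating_point hDn
    (a := ⟨a, ha⟩) (b := ⟨b, hb⟩) (fun h => hab (congrArg Subtype.val h))
  obtain ⟨P', hP', rfl⟩ := isOpen_induced_iff.1 hP
  obtain ⟨Q', hQ', rfl⟩ := isOpen_induced_iff.1 hQ
  refine ⟨c, c.2, P', Q', hP', hQ', fun y hy h1 h2 => ?_, fun y hy => ?_, haP, hbQ⟩
  · exact hPQ.notMem_of_mem_left (a := ⟨y, hy⟩) h1 h2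
  · have := Set.ext_iff.1 hc ⟨y, hy⟩
    rw [mem_compl_singleton_iff, ne_eq, Subtype.ext_iff] at this
    exact this

/-- Local dendrites are regular curves: points have small neighbourhoods with finite frontier. -/
theorem IsLocalDendrite.exists_isOpen_finite_frontier {X : Type*} [MetricSpace X] [CompactSpace X]
    (hX : IsLocalDendrite X) {x : X} {V : Set X} (hV : V ∈ 𝓝 x) :
    ∃ U, IsOpen U ∧ x ∈ U ∧ closure U ⊆ V ∧ (frontier U).Finite := by
  obtain ⟨N, hN, -, hsep⟩ := hX.exists_nhds_separating x
  obtain ⟨ε, hε, hball⟩ := Metric.nhds_basis_closedBall.mem_iff.1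
    (inter_mem hV (interior_mem_nhds.2 hN))
  set V₀ := Metric.ball x ε
  have hcl : closure V₀ ⊆ V ∩ interior N := Metric.closure_ball_subset_closedBall.trans hball
  have hxV₀ : x ∈ V₀ := Metric.mem_ball_self hε
  have hV₀ : IsOpen V₀ := Metric.isOpen_ball
  have h : ∀ y : frontier V₀, ∃ c ∈ N, ∃ P Q : Set X, IsOpen P ∧ IsOpen Q ∧
      (∀ y ∈ N, y ∈ P → y ∉ Q) ∧ (∀ y ∈ N, y ∈ P ∪ Q ↔ y ≠ c) ∧ x ∈ P ∧ y.1 ∈ Q := fun y =>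
    hsep x (mem_of_mem_nhds hN) y (interior_subset (hcl y.2.1).2) fun hxy => by
      have := y.2.2
      rw [hV₀.interior_eq, ← hxy] at this
      exact this hxV₀
  choose c _ P Q hP hQ hPQ hc hxP hyQ using h
  obtain ⟨t, ht⟩ := (isClosed_frontier (s := V₀)).isCompact.elim_finite_subcover Q hQ
    fun y hy => mem_iUnion.2 ⟨⟨y, hy⟩, hyQ _⟩
  refine ⟨V₀ ∩ ⋂ y ∈ t, P y, hV₀.inter (isOpen_biInter_finset fun y _ => hP y),
    ⟨hxV₀, mem_iInter₂.2 fun y _ => hxP y⟩,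
    (closure_mono inter_subset_left).trans (hcl.trans inter_subset_left), ?_⟩
  refine (t.finite_toSet.image c).subset ?_
  rintro w ⟨hw, hwU⟩
  rw [(hV₀.inter (isOpen_biInter_finset fun y _ => hP y)).interior_eq] at hwU
  have hwV : w ∈ closure V₀ := closure_mono inter_subset_left hw
  have hwN := (hcl hwV).2
  have hwQ : ∀ y ∈ t, w ∉ Q y := by
    intro y hy hwQ
    obtain ⟨z, ⟨hzQ, hzN⟩, hzU⟩ := mem_closure_iff.1 hw _ ((hQ y).inter isOpen_interior) ⟨hwQ, hwN⟩
    exact hPQ y z (interior_subset hzN) (mem_iInter₂.1 hzU.2 y hy) hzQ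
  by_contra hwc
  refine hwU ⟨?_, mem_iInter₂.2 fun y hy => ?_⟩
  · by_contra hwV'
    obtain ⟨y, hy, hyw⟩ := mem_iUnion₂.1 (ht ⟨hwV, by rwa [hV₀.interior_eq]⟩)
    exact hwQ y hy hyw
  · exact ((hc y w (interior_subset hwN)).2 (by
      rintro rfl
      exact hwc ⟨y, hy, rfl⟩)).resolve_right (hwQ y hy)

theorem IsLocalDendrite.exists_finset_small {X : Type*} [MetricSpace X] [CompactSpace X]
    [Nonempty X] (hX : IsLocalDendrite X) {ε : ℝ} (hε : 0 < ε) :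
    ∃ F : Finset X, F.Nonempty ∧ ∀ S : Set X, IsPreconnected S → Disjoint S F →
      ∀ x ∈ S, ∀ y ∈ S, dist x y < ε := by
  classical
  choose U hU hxU hcl hfin using fun x : X =>
    hX.exists_isOpen_finite_frontier (Metric.ball_mem_nhds x (half_pos hε))
  obtain ⟨t, ht⟩ := isCompact_univ.elim_finite_subcover U hU
    fun x _ => mem_iUnion.2 ⟨x, hxU x⟩
  obtain ⟨x₀⟩ := ‹Nonempty X›
  refine ⟨insert x₀ (t.biUnion fun x => (hfin x).toFinset), Finset.insert_nonempty _ _,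
    fun S hS hd x hx y hy => ?_⟩
  obtain ⟨z, hz, hxz⟩ := mem_iUnion₂.1 (ht (mem_univ x))
  have hsub : S ⊆ U z := hS.subset_of_disjoint_frontier (hU z) ⟨x, hx, hxz⟩
    (hd.mono_right fun w hw => by
      simp only [Finset.coe_insert, Finset.coe_biUnion, Finite.coe_toFinset]
      exact Or.inr (mem_biUnion (Finset.mem_coe.2 hz) hw))
  have h1 := hcl z (subset_closure (hsub hx))
  have h2 := hcl z (subset_closure (hsub hy))
  rw [Metric.mem_ball] at h1 h2
  linarith [dist_triangle_right x y z]

theorem dynDist_lt_iff {X : Type*} [PseudoMetricSpace X] {f : X → X} {n : ℕ} {x y : X} {ε : ℝ}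
    (hε : 0 < ε) : dynDist f n x y < ε ↔ ∀ k < n, dist (f^[k] x) (f^[k] y) < ε := by
  lift ε to ℝ≥0 using hε.le
  rw [dynDist, NNReal.coe_lt_coe, Finset.sup_lt_iff (by exact_mod_cast hε)]
  simp only [Finset.mem_range, ← NNReal.coe_lt_coe, coe_nndist]

theorem sepCount_le {X : Type*} [PseudoMetricSpace X] {f : X → X} {n c : ℕ} {ε : ℝ}
    (h : ∀ E : Finset X, IsDynSeparated f n ε (E : Set X) → E.card ≤ c) : sepCount f n ε ≤ c :=
  iSup₂_le fun E hE => by exact_mod_cast h E hE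

theorem le_sepCount {X : Type*} [PseudoMetricSpace X] {f : X → X} {n : ℕ} {ε : ℝ}
    {E : Finset X} (h : IsDynSeparated f n ε (E : Set X)) : (E.card : ℕ∞) ≤ sepCount f n ε :=
  le_iSup₂ (f := fun (E : Finset X) (_ : IsDynSeparated f n ε (E : Set X)) => (E.card : ℕ∞)) E h

theorem polGrowth_le {u : ℕ → ℕ∞} {c d : ℕ} (h : ∀ n, 1 ≤ n → u n ≤ (n ^ d * c : ℕ)) :
    polGrowth u ≤ d := by
  have hlog : Tendsto (fun n : ℕ => Real.log n) atTop atTop :=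
    Real.tendsto_log_atTop.comp tendsto_natCast_atTop_atTop
  have hlim : Tendsto (fun n : ℕ => ENNReal.ofReal (d + Real.log (c + 1) / Real.log n)) atTop
      (𝓝 (d : ℝ≥0∞)) := by
    have : Tendsto (fun n : ℕ => (d + Real.log (c + 1) / Real.log n : ℝ)) atTop (𝓝 (d + 0)) :=
      tendsto_const_nhds.add (tendsto_const_nhds.div_atTop hlog)
    rw [add_zero] at this
    simpa using ENNReal.tendsto_ofReal this
  rw [← hlim.limsup_eq]
  refine limsup_le_limsup ?_
  filter_upwards [eventually_ge_atTop 2] with n hn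
  have h1 := h n (by omega)
  rw [if_neg (ne_top_of_le_ne_top (ENat.natCast_ne_top _) h1)]
  refine ENNReal.ofReal_le_ofReal ?_
  have hln : 0 < Real.log n := Real.log_pos (by exact_mod_cast hn)
  have hlc : 0 ≤ Real.log (c + 1) := Real.log_nonneg (by linarith [(Nat.cast_nonneg c : (0 : ℝ) ≤ c)])
  have hn0 : (0 : ℝ) < n := by positivity
  have hc0 : (0 : ℝ) ≤ c := Nat.cast_nonneg c
  have h2 : ((u n).toNat : ℝ) ≤ n ^ d * (c + 1) := by
    have h3 : (u n).toNat ≤ n ^ d * c := ENat.toNat_le_toNat h1 (ENat.natCast_ne_top _)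
    calc ((u n).toNat : ℝ) ≤ ((n ^ d * c : ℕ) : ℝ) := by exact_mod_cast h3
      _ ≤ n ^ d * (c + 1) := by
        push_cast
        exact mul_le_mul_of_nonneg_left (by linarith) (by positivity)
  rw [div_le_iff₀ hln, add_mul, div_mul_cancel₀ _ hln.ne']
  rcases (Nat.cast_nonneg (u n).toNat : (0 : ℝ) ≤ _).eq_or_lt with h0 | h0
  · rw [← h0, Real.log_zero]
    positivity
  · calc Real.log (u n).toNat ≤ Real.log (n ^ d * (c + 1)) := Real.log_le_log h0 h2
      _ = d * Real.log n + Real.log (c + 1) := by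
        rw [Real.log_mul (by positivity) (by positivity), Real.log_pow]

theorem le_polGrowth {u : ℕ → ℕ∞} (h : ∀ n : ℕ, (n : ℕ∞) ≤ u n) : 1 ≤ polGrowth u := by
  refine le_limsup_of_frequently_le' (Eventually.frequently ?_)
  filter_upwards [eventually_ge_atTop 2] with n hn
  split_ifs with ht
  · exact le_top
  · rw [← ENNReal.ofReal_one]
    refine ENNReal.ofReal_le_ofReal ?_
    have hln : 0 < Real.log n := Real.log_pos (by exact_mod_cast hn)
    rw [one_le_div hln]
    have h1 : n ≤ (u n).toNat := by
      have := h n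
      rwa [← ENat.natCast_toNat ht, Nat.cast_le] at this
    exact Real.log_le_log (by positivity) (by exact_mod_cast h1)

theorem IsHomeomorph.iterate {X : Type*} [TopologicalSpace X] {f : X → X} (hf : IsHomeomorph f)
    (n : ℕ) : IsHomeomorph f^[n] := by
  induction n with
  | zero => exact IsHomeomorph.id
  | succ n ih => exact ih.comp hf

theorem IsLocalDendrite.hpol_le_one {X : Type*} [MetricSpace X] [CompactSpace X]
    [ConnectedSpace X] (hX : IsLocalDendrite X) {f : X → X} (hf : IsHomeomorph f) : hpol f ≤ 1 := by
  classical
  have := hX.locallyConnectedSpace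
  refine iSup₂_le fun ε hε => ?_
  obtain ⟨F, ⟨z, hz⟩, hF⟩ := hX.exists_finset_small (show 0 < ε / 3 by positivity)
  rw [← Nat.cast_one (R := ℝ≥0∞)]
  refine polGrowth_le (c := F.card) fun n hn => sepCount_le fun E hE => ?_
  set F' : Finset X := (Finset.range n).biUnion fun k =>
    F.preimage f^[k] (hf.iterate k).injective.injOn with hF'
  have hcard : F'.card ≤ n ^ 1 * F.card := by
    refine Finset.card_biUnion_le.trans ((Finset.sum_le_card_nsmul _ _ F.card fun k _ => ?_).trans ?_)
    · rw [← Finset.card_image_of_injective _ (hf.iterate k).injective]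
      exact Finset.card_le_card (Finset.image_subset_iff.2 fun x hx => Finset.mem_preimage.1 hx)
    · simp
  have hmem : ∀ x, x ∈ F' ↔ ∃ k < n, f^[k] x ∈ F := fun x => by simp [hF']
  have key : ∀ x, ∃ y ∈ F', dynDist f n x y < ε / 2 := by
    intro x
    by_cases hx : x ∈ F'
    · exact ⟨x, hx, (dynDist_lt_iff (half_pos hε)).2 fun k _ => by simpa using half_pos hε⟩
    set C := connectedComponentIn (F' : Set X)ᶜ x with hC
    have hxC : x ∈ C := mem_connectedComponentIn (by simpa using hx)
    have hCF : C ⊆ (F' : Set X)ᶜ := connectedComponentIn_subset _ _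
    have hCo : IsOpen C := (F'.finite_toSet.isClosed.isOpen_compl).connectedComponentIn
    obtain ⟨y, hy⟩ : (frontier C).Nonempty := nonempty_frontier_iff.2 ⟨⟨x, hxC⟩, fun h => by
      have hzC : z ∈ C := h ▸ mem_univ z
      exact hCF hzC ((hmem z).2 ⟨0, hn, hz⟩)⟩
    rw [hCo.frontier_eq] at hy
    refine ⟨y, ?_, (dynDist_lt_iff (half_pos hε)).2 fun k hk => ?_⟩
    · by_contra hyF
      refine hy.2 ?_
      have h1 : IsPreconnected (insert y C) :=
        isPreconnected_connectedComponentIn.subset_closure (subset_insert _ _)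
          (insert_subset hy.1 subset_closure)
      exact h1.subset_connectedComponentIn (mem_insert_of_mem _ hxC)
        (insert_subset (by simpa using hyF) hCF) (mem_insert _ _)
    · have h1 := hF (f^[k] '' C) (isPreconnected_connectedComponentIn.image _
        (hf.iterate k).continuous.continuousOn) (disjoint_left.2 (by
          rintro _ ⟨w, hw, rfl⟩ hwF
          exact hCF hw ((hmem w).2 ⟨k, hk, hwF⟩)))
      have h2 : dist (f^[k] x) (f^[k] y) ≤ ε / 3 := by
        have hcl : IsClosed {w | dist (f^[k] x) (f^[k] w) ≤ ε / 3} :=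
          isClosed_le (continuous_const.dist (hf.iterate k).continuous) continuous_const
        exact closure_minimal (fun w hw => (h1 _ (mem_image_of_mem _ hxC) _
          (mem_image_of_mem _ hw)).le) hcl hy.1
      linarith
  choose φ hφ hd using key
  refine le_trans (Finset.card_le_card_of_injOn φ (fun x _ => hφ x) fun x hx y hy hxy => ?_) hcard
  by_contra hne
  refine absurd (hE x hx y hy hne) (not_le.2 ((dynDist_lt_iff hε).2 fun k hk => ?_))
  have h1 := (dynDist_lt_iff (half_pos hε)).1 (hd x) k hk
  have h2 := (dynDist_lt_iff (half_pos hε)).1 (hd y) k hk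
  rw [← hxy] at h2
  linarith [dist_triangle_right (f^[k] x) (f^[k] y) (f^[k] (φ x))]

theorem one_le_hpol_of_isWanderingPoint {X : Type*} [MetricSpace X] {f : X → X}
    (hf : IsHomeomorph f) {p : X} (hp : IsWanderingPoint f p) : 1 ≤ hpol f := by
  classical
  obtain ⟨U, hU, hpU, hUw⟩ := hp
  obtain ⟨ε, hε, hball⟩ := Metric.isOpen_iff.1 hU p hpU
  refine le_trans (le_polGrowth fun n => ?_)
    (le_iSup₂ (f := fun (ε : ℝ) (_ : 0 < ε) => polGrowth fun n => sepCount f n ε) ε hε)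
  choose q hq using fun k => (hf.iterate k).surjective p
  have hfar : ∀ i j, i < j → ε ≤ dist (f^[j] (q i)) (f^[j] (q j)) := by
    intro i j hij
    rw [hq]
    by_contra! h
    have h1 : f^[j] (q i) = f^[j - i] p := by
      rw [← hq i, ← Function.iterate_add_apply, Nat.sub_add_cancel hij.le]
    have : f^[j - i] p ∈ f^[j - i] '' U ∩ U := ⟨⟨p, hpU, rfl⟩, hball (by rwa [Metric.mem_ball, ← h1])⟩
    rw [hUw _ (by omega)] at this
    exact this
  have hfar' : ∀ i < n, ∀ j < n, i ≠ j → ε ≤ dynDist f n (q i) (q j) := by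
    intro i hi j hj hij
    by_contra! h
    rw [dynDist_lt_iff hε] at h
    rcases lt_or_gt_of_ne hij with h1 | h1
    · exact absurd (h j hj) (not_lt.2 (hfar i j h1))
    · have := h i hi
      rw [dist_comm] at this
      exact absurd this (not_lt.2 (hfar j i h1))
  have hinj : InjOn q (Finset.range n : Finset ℕ) := by
    intro i hi j hj hij
    by_contra hne
    have := hfar' i (by simpa using hi) j (by simpa using hj) hne
    rw [← not_lt, dynDist_lt_iff hε, hij] at this
    exact this fun k _ => by simpa using hε
  have := le_sepCount (f := f) (n := n) (ε := ε) (E := (Finset.range n).image q) (by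
    intro x hx y hy hxy
    simp only [Finset.coe_image, Finset.coe_range, mem_image, mem_Iio] at hx hy
    obtain ⟨i, hi, rfl⟩ := hx
    obtain ⟨j, hj, rfl⟩ := hy
    exact hfar' i hi j hj (by rintro rfl; exact hxy rfl))
  rwa [Finset.card_image_of_injOn hinj, Finset.card_range] at this

/-- A map with uniformly equicontinuous iterates has polynomial entropy zero. -/
theorem hpol_eq_zero_of_equicontinuous {X : Type*} [MetricSpace X] [CompactSpace X] {f : X → X}
    (h : ∀ ε > 0, ∃ δ > 0, ∀ x y : X, dist x y < δ → ∀ k, dist (f^[k] x) (f^[k] y) < ε) :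
    hpol f = 0 := by
  refine le_antisymm (iSup₂_le fun ε hε => ?_) zero_le
  obtain ⟨δ, hδ, h⟩ := h ε hε
  obtain ⟨t, -, ht⟩ := isCompact_univ.elim_finite_subcover_image (b := (univ : Set X))
    (c := fun x : X => Metric.ball x (δ / 2)) (fun x _ => Metric.isOpen_ball)
    (fun x _ => mem_biUnion (mem_univ x) (Metric.mem_ball_self (half_pos hδ)))
  have htf := ht.1
  rw [← Nat.cast_zero (R := ℝ≥0∞)]
  refine polGrowth_le (c := htf.toFinset.card) fun n hn => sepCount_le fun E hE => ?_
  rw [pow_zero, one_mul]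
  choose φ hφ hd using fun x : X => mem_iUnion₂.1 (ht.2 (mem_univ x))
  refine Finset.card_le_card_of_injOn φ (fun x _ => by simpa using hφ x) fun x hx y hy hxy => ?_
  by_contra hne
  refine absurd (hE x hx y hy hne) (not_le.2 ((dynDist_lt_iff hε).2 fun k _ => h x y ?_ k))
  have h1 := hd x
  have h2 := hd y
  rw [← hxy] at h2
  rw [Metric.mem_ball] at h1 h2
  linarith [dist_triangle_right x y (φ x)]

/-- A homeomorphism without wandering points: every nonempty open set returns to itself. -/
def Homeomorph.Nonwandering {X : Type*} [TopologicalSpace X] (g : X ≃ₜ X) : Prop :=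
  ∀ U : Set X, IsOpen U → U.Nonempty → ∃ n : ℕ, 1 ≤ n ∧ ∃ x ∈ U, (g ^ n) x ∈ U

section Nonwandering

variable {X : Type*} [TopologicalSpace X] {g : X ≃ₜ X}

theorem Homeomorph.pow_add_apply (g : X ≃ₜ X) (m n : ℕ) (x : X) :
    (g ^ (m + n)) x = (g ^ m) ((g ^ n) x) := by
  rw [pow_add, Homeomorph.mul_apply]

theorem Homeomorph.inv_apply_eq_iff' (g : X ≃ₜ X) {x y : X} : g⁻¹ x = y ↔ x = g y := by
  rw [Homeomorph.inv_apply]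
  exact g.toEquiv.symm_apply_eq

theorem Homeomorph.pow_apply_eq_self {g : X ≃ₜ X} {x : X} (h : g x = x) (n : ℕ) :
    (g ^ n) x = x := by
  induction n with
  | zero => rfl
  | succ n ih => rw [pow_succ, Homeomorph.mul_apply, h, ih]

theorem Homeomorph.Nonwandering.inv (hg : g.Nonwandering) : g⁻¹.Nonwandering := by
  intro U hU hne
  obtain ⟨n, hn, x, hx, hgx⟩ := hg U hU hne
  refine ⟨n, hn, (g ^ n) x, hgx, ?_⟩
  rwa [inv_pow, (g ^ n).inv_apply_eq_iff'.2 rfl]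

theorem Homeomorph.Nonwandering.exists_strictMono (hg : g.Nonwandering) {U : Set X}
    (hU : IsOpen U) (hne : U.Nonempty) (k : ℕ) :
    ∃ s : ℕ → ℕ, ∃ V : Set X, (∀ i ≤ k, ∀ j < i, s j < s i) ∧ IsOpen V ∧ V.Nonempty ∧
      ∀ i ≤ k, ∀ x ∈ V, (g ^ s i) x ∈ U := by
  induction k with
  | zero => exact ⟨fun _ => 0, U, by simp, hU, hne, by simp⟩
  | succ k ih =>
    obtain ⟨s, V, hs, hV, hVne, hVU⟩ := ih
    obtain ⟨n, hn, x, hx, hgx⟩ := hg V hV hVne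
    refine ⟨fun i => if i = k + 1 then n + s k else s i, V ∩ (g ^ n) ⁻¹' V, ?_,
      hV.inter (hV.preimage (g ^ n).continuous), ⟨x, hx, hgx⟩, ?_⟩
    · intro i hi j hj
      simp only
      rw [if_neg (by omega : j ≠ k + 1)]
      split_ifs with h
      · rcases (by omega : j = k ∨ j < k) with rfl | h'
        · omega
        · have := hs k le_rfl j h'
          omega
      · exact hs i (by omega) j hj
    · rintro i hi y ⟨hy, hy'⟩
      simp only
      split_ifs with h
      · rw [add_comm, Homeomorph.pow_add_apply]
        exact hVU k le_rfl _ hy'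
      · exact hVU i (by omega) y hy

theorem Homeomorph.Nonwandering.pow (hg : g.Nonwandering) {m : ℕ} (hm : 1 ≤ m) :
    (g ^ m).Nonwandering := by
  intro U hU hne
  obtain ⟨s, V, hs, hV, ⟨x, hx⟩, hVU⟩ := hg.exists_strictMono hU hne m
  obtain ⟨i, hi, j, hj, hij, h⟩ := Finset.exists_ne_map_eq_of_card_lt_of_maps_to
    (s := Finset.range (m + 1)) (t := Finset.range m) (by simp) (f := fun i => s i % m)
    (fun i _ => by simpa using Nat.mod_lt _ (by omega))
  rw [Finset.mem_range] at hi hj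
  wlog hlt : j < i generalizing i j
  · exact this j hj i hi hij.symm h.symm (by omega)
  have h1 := hs i (by omega) j hlt
  obtain ⟨q, hq⟩ := (Nat.modEq_iff_dvd' h1.le).1 h.symm
  refine ⟨q, ?_, (g ^ s j) x, hVU j (by omega) x hx, ?_⟩
  · rcases q.eq_zero_or_pos with rfl | hq0
    · omega
    · exact hq0
  · rw [← pow_mul, ← hq, ← Homeomorph.pow_add_apply, Nat.sub_add_cancel h1.le]
    exact hVU i (by omega) x hx

theorem Homeomorph.Nonwandering.exists_return_ge (hg : g.Nonwandering) {U : Set X}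
    (hU : IsOpen U) (hne : U.Nonempty) (N : ℕ) : ∃ n ≥ N, ∃ x ∈ U, (g ^ n) x ∈ U := by
  obtain ⟨n, hn, x, hx, h⟩ := hg.pow (m := N + 1) (by omega) U hU hne
  exact ⟨(N + 1) * n, by nlinarith, x, hx, by rwa [pow_mul]⟩

end Nonwandering

/-- If a point `p` splits a connected set `N` into two pieces, each piece becomes connected once `p`
is added. -/
theorem IsPreconnected.sdiff_of_separated {X : Type*} [TopologicalSpace X] {N P Q : Set X} {p : X}
    (hN : IsPreconnected N) (hP : IsOpen P) (hQ : IsOpen Q)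
    (hd : ∀ y ∈ N, y ∈ P → y ∉ Q) (h : ∀ y ∈ N, y ∈ P ∪ Q ↔ y ≠ p) (hp : p ∈ N) :
    IsPreconnected (N \ Q) := by
  have hpQ : p ∉ Q := fun hh => (h p hp).1 (Or.inr hh) rfl
  have key : ∀ u v : Set X, IsOpen u → IsOpen v → N \ Q ⊆ u ∪ v → p ∈ u →
      (N \ Q ∩ v).Nonempty → (N \ Q ∩ (u ∩ v)).Nonempty := by
    rintro u v hu hv hc hpu ⟨z, hz, hzv⟩
    by_contra hne
    have hne' : ∀ y ∈ N, y ∉ Q → y ∈ u → y ∉ v := fun y h1 h2 h3 h4 => hne ⟨y, ⟨h1, h2⟩, h3, h4⟩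
    have hzu : z ∉ u := fun hh => hne' z hz.1 hz.2 hh hzv
    have hzp : z ≠ p := by rintro rfl; exact hzu hpu
    obtain ⟨y, hyN, ⟨hyv, hyP⟩, hyu⟩ := hN (v ∩ P) (u ∪ Q) (hv.inter hP) (hu.union hQ) (by
        intro y hy
        by_cases hyQ : y ∈ Q
        · exact Or.inr (Or.inr hyQ)
        rcases hc ⟨hy, hyQ⟩ with h1 | h1
        · exact Or.inr (Or.inl h1)
        · by_cases hyp : y = p
          · exact Or.inr (Or.inl (hyp ▸ hpu))
          · exact Or.inl ⟨h1, ((h y hy).2 hyp).resolve_right hyQ⟩)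
      ⟨z, hz.1, hzv, ((h z hz.1).2 hzp).resolve_right hz.2⟩ ⟨p, hp, Or.inl hpu⟩
    have hyQ := hd y hyN hyP
    exact hne' y hyN hyQ (hyu.resolve_right hyQ) hyv
  intro u v hu hv hc hune hvne
  rcases hc ⟨hp, hpQ⟩ with hpu | hpv
  · exact key u v hu hv hc hpu hvne
  · rw [inter_comm u v]
    exact key v u hv hu (by rwa [union_comm]) hpv hune

/-- The point `p` cuts the space into the nonempty disjoint open sets `G` and `G'`. -/
structure IsCut {X : Type*} [TopologicalSpace X] (p : X) (G G' : Set X) : Prop where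
  isOpen : IsOpen G
  isOpen' : IsOpen G'
  notMem : ∀ y ∈ G, y ∉ G'
  mem_iff : ∀ y, y ∈ G ∪ G' ↔ y ≠ p
  nonempty : G.Nonempty
  nonempty' : G'.Nonempty

namespace IsCut

variable {X : Type*} [TopologicalSpace X] {p : X} {G G' : Set X}

theorem symm (hc : IsCut p G G') : IsCut p G' G :=
  ⟨hc.isOpen', hc.isOpen, fun y h h' => hc.notMem y h' h, fun y => by rw [union_comm, hc.mem_iff],
    hc.nonempty', hc.nonempty⟩

theorem point_notMem (hc : IsCut p G G') : p ∉ G := fun h => (hc.mem_iff p).1 (Or.inl h) rfl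

theorem eq_of_notMem (hc : IsCut p G G') {y : X} (h : y ∉ G) (h' : y ∉ G') : y = p := by
  by_contra hy
  exact ((hc.mem_iff y).2 hy).elim h h'

theorem isPreconnected_compl [PreconnectedSpace X] (hc : IsCut p G G') : IsPreconnected Gᶜ := by
  rw [compl_eq_univ_sdiff]
  exact isPreconnected_univ.sdiff_of_separated hc.isOpen' hc.isOpen
    (fun y _ h h' => hc.notMem y h' h) (fun y _ => by rw [union_comm, hc.mem_iff]) (mem_univ p)

theorem closure_subset (hc : IsCut p G G') : closure G ⊆ insert p G := by
  intro y hy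
  by_contra hne
  rw [mem_insert_iff, not_or] at hne
  obtain ⟨z, hz', hz⟩ := mem_closure_iff.1 hy G' hc.isOpen'
    (((hc.mem_iff y).2 hne.1).resolve_left hne.2)
  exact hc.notMem z hz hz'

theorem point_mem_closure [PreconnectedSpace X] (hc : IsCut p G G') : p ∈ closure G := by
  by_contra hp
  have hcl : IsClosed G := isClosed_of_closure_subset fun y hy =>
    (hc.closure_subset hy).resolve_left (by rintro rfl; exact hp hy)
  have : G = univ := IsClopen.eq_univ ⟨hcl, hc.isOpen⟩ hc.nonempty
  exact hc.point_notMem (this ▸ mem_univ p)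

theorem false_of_nested [PreconnectedSpace X] (hc : IsCut p G G') {h : X ≃ₜ X}
    (hh : h.Nonwandering) (hG : ∀ x ∈ G, h x ∈ G) (hp : h p ∈ G) : False := by
  have hsub : G ⊆ closure (h '' G) := by
    by_contra hne
    obtain ⟨z, hz⟩ := nonempty_of_not_subset hne
    obtain ⟨n, hn, x, hx, hx'⟩ := hh (G \ closure (h '' G)) (hc.isOpen.sdiff isClosed_closure) ⟨z, hz⟩
    have hpow : ∀ n, (h ^ n) x ∈ G := fun n => by
      induction n with
      | zero => exact hx.1
      | succ n ih => rw [pow_succ', Homeomorph.mul_apply]; exact hG _ ih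
    obtain ⟨m, rfl⟩ := Nat.exists_eq_succ_of_ne_zero (by omega : n ≠ 0)
    refine hx'.2 (subset_closure ⟨(h ^ m) x, hpow m, ?_⟩)
    rw [Nat.succ_eq_add_one, pow_succ', Homeomorph.mul_apply]
  obtain ⟨y, hy, hy'⟩ := mem_closure_iff.1 hc.symm.point_mem_closure (h ⁻¹' G)
    (hc.isOpen.preimage h.continuous) hp
  have h1 := hsub hy
  rw [← h.image_closure] at h1
  obtain ⟨z, hz, hzy⟩ := h1
  obtain rfl := h.injective hzy
  rcases hc.closure_subset hz with rfl | hz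
  · exact hc.symm.point_notMem hy'
  · exact hc.notMem z hz hy'

theorem maps_compl [PreconnectedSpace X] (hc : IsCut p G G') {h : X ≃ₜ X}
    (hh : h.Nonwandering) (hp : h p ∈ G) : ∀ x, x ∉ G → h x ∈ G := by
  have key : ∀ A : Set X, IsPreconnected A → p ∈ A → (∀ x ∈ A, h x ≠ p) → ∀ x ∈ A, h x ∈ G := by
    intro A hA hpA hne x hx
    have := (hA.image h h.continuous.continuousOn).subset_left_of_subset_union hc.isOpen hc.isOpen'
      (disjoint_left.2 fun y => hc.notMem y)
      (by rintro _ ⟨z, hz, rfl⟩; exact (hc.mem_iff _).2 (hne z hz)) ⟨h p, mem_image_of_mem h hpA, hp⟩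
    exact this ⟨x, hx, rfl⟩
  by_cases hz : ∃ z ∈ Gᶜ, h z = p
  · obtain ⟨z, hz, hzp⟩ := hz
    refine (hc.false_of_nested hh (fun x hx => ?_) hp).elim
    refine key G'ᶜ hc.symm.isPreconnected_compl hc.symm.point_notMem ?_ x (hc.notMem x hx)
    rintro y hy hyp
    obtain rfl := h.injective (hyp.trans hzp.symm)
    have := hc.eq_of_notMem hz hy
    subst this
    rw [hzp] at hp
    exact hc.point_notMem hp
  · push Not at hz
    exact key Gᶜ hc.isPreconnected_compl hc.point_notMem hz

theorem exists_pow_apply_eq [PreconnectedSpace X] (hc : IsCut p G G') {g : X ≃ₜ X}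
    (hg : g.Nonwandering) : ∃ n : ℕ, 1 ≤ n ∧ (g ^ n) p = p := by
  by_contra! hne
  have key : ∀ A A' : Set X, IsCut p A A' → ∃ k : ℕ, 1 ≤ k ∧ ∀ x, x ∉ A → (g ^ k) x ∈ A := by
    intro A A' hA
    obtain ⟨k, hk, x, hx, hx'⟩ := hg A hA.isOpen hA.nonempty
    refine ⟨k, hk, hA.maps_compl (hg.pow hk) ?_⟩
    refine ((hA.mem_iff _).2 (hne k hk)).resolve_right fun hp => ?_
    exact hA.notMem _ hx' (hA.symm.maps_compl (hg.pow hk) hp x (hA.notMem x hx))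
  obtain ⟨k, hk, h1⟩ := key G G' hc
  obtain ⟨l, hl, h2⟩ := key G' G hc.symm
  have h3 : ∀ x, x ∉ G' → (g ^ (k + l)) x ∈ G := fun x hx => by
    rw [Homeomorph.pow_add_apply]
    exact h1 _ (hc.symm.notMem _ (h2 x hx))
  exact hc.false_of_nested (hg.pow (m := k + l) (by omega)) (fun x hx => h3 x (hc.notMem x hx))
    (h3 p hc.symm.point_notMem)

end IsCut

theorem mem_connectedComponentIn_of_mem_closure {X : Type*} [TopologicalSpace X] {F : Set X}
    {x y : X} (hx : x ∈ F) (hy : y ∈ closure (connectedComponentIn F x)) (hyF : y ∈ F) :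
    y ∈ connectedComponentIn F x := by
  have h : IsPreconnected (insert y (connectedComponentIn F x)) :=
    isPreconnected_connectedComponentIn.subset_closure (subset_insert _ _)
      (insert_subset hy subset_closure)
  exact h.subset_connectedComponentIn (mem_insert_of_mem _ (mem_connectedComponentIn hx))
    (insert_subset hyF (connectedComponentIn_subset F x)) (mem_insert _ _)

/-- The point `c` cuts the set `N` into its intersections with the open sets `P` and `Q`. -/
structure IsCutOn {X : Type*} [TopologicalSpace X] (N : Set X) (c : X) (P Q : Set X) : Prop where
  mem : c ∈ N
  isOpen : IsOpen P
  isOpen' : IsOpen Q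
  notMem : ∀ y ∈ N, y ∈ P → y ∉ Q
  mem_iff : ∀ y ∈ N, y ∈ P ∪ Q ↔ y ≠ c

namespace IsCutOn

variable {X : Type*} [TopologicalSpace X] {N : Set X} {c c' b : X} {P Q P' Q' : Set X}

theorem symm (h : IsCutOn N c P Q) : IsCutOn N c Q P :=
  ⟨h.mem, h.isOpen', h.isOpen, fun y hy h1 h2 => h.notMem y hy h2 h1,
    fun y hy => by rw [union_comm, h.mem_iff y hy]⟩

theorem notMem_point (h : IsCutOn N c P Q) : c ∉ P := fun hh => (h.mem_iff c h.mem).1 (Or.inl hh) rfl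

theorem isPreconnected_sdiff (h : IsCutOn N c P Q) (hN : IsPreconnected N) :
    IsPreconnected (N \ Q) :=
  hN.sdiff_of_separated h.isOpen h.isOpen' h.notMem h.mem_iff h.mem

theorem mem_of_isPreconnected (h : IsCutOn N c P Q) {A : Set X} (hA : IsPreconnected A)
    (hAN : A ⊆ N) (hP : (A ∩ P).Nonempty) (hQ : (A ∩ Q).Nonempty) : c ∈ A := by
  by_contra hc
  obtain ⟨y, hy, h1, h2⟩ := hA P Q h.isOpen h.isOpen'
    (fun y hy => (h.mem_iff y (hAN hy)).2 (by rintro rfl; exact hc hy)) hP hQ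
  exact h.notMem y (hAN hy) h1 h2

theorem sdiff_subset_of_mem (h : IsCutOn N c P Q) (h' : IsCutOn N c' P' Q')
    (hN : IsPreconnected N) (hc : c ∈ P') (hb : b ∈ N) (hbQ : b ∈ Q) (hbQ' : b ∈ Q') :
    N \ Q ⊆ P' := by
  have hc' : c' ∈ N \ P := h'.mem_of_isPreconnected (h.symm.isPreconnected_sdiff hN) sdiff_subset
    ⟨c, ⟨h.mem, h.notMem_point⟩, hc⟩ ⟨b, ⟨hb, fun hbP => h.notMem b hb hbP hbQ⟩, hbQ'⟩
  have hne : c' ≠ c := by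
    rintro rfl
    exact h'.notMem_point hc
  have hcQ : c' ∈ Q := ((h.mem_iff c' hc'.1).2 hne).resolve_left hc'.2
  intro y hy
  by_contra hyP
  by_cases hyc : y = c'
  · subst hyc
    exact hy.2 hcQ
  · have hyQ : y ∈ Q' := ((h'.mem_iff y hy.1).2 hyc).resolve_left hyP
    have := h'.mem_of_isPreconnected (h.isPreconnected_sdiff hN) sdiff_subset
      ⟨c, ⟨h.mem, h.symm.notMem_point⟩, hc⟩ ⟨y, hy, hyQ⟩
    exact this.2 hcQ

theorem point_mem_closure (h : IsCutOn N c P Q) (hN : IsPreconnected N) (hQ : (N ∩ Q).Nonempty) :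
    c ∈ closure (N ∩ Q) := by
  refine mem_closure_iff.2 fun O hO hcO => ?_
  by_contra hne
  obtain ⟨y, hy, h1, h2⟩ := hN (O ∪ P) Q (hO.union h.isOpen) h.isOpen' (by
    intro y hy
    by_cases hyc : y = c
    · exact Or.inl (Or.inl (hyc ▸ hcO))
    · rcases (h.mem_iff y hy).2 hyc with h1 | h1
      · exact Or.inl (Or.inr h1)
      · exact Or.inr h1) ⟨c, h.mem, Or.inl hcO⟩ hQ
  rcases h1 with h1 | h1
  · exact hne ⟨y, h1, hy, h2⟩
  · exact h.notMem y hy h1 h2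

end IsCutOn

/-- In a set all of whose pairs of points can be cut, there is a sequence of cuts moving from `a`
towards `b`. -/
theorem exists_seq_isCutOn {X : Type*} [TopologicalSpace X] {N : Set X} (hN : IsPreconnected N)
    (hsep : ∀ a ∈ N, ∀ b ∈ N, a ≠ b → ∃ c P Q, IsCutOn N c P Q ∧ a ∈ P ∧ b ∈ Q)
    {a b : X} (ha : a ∈ N) (hb : b ∈ N) (hab : a ≠ b) :
    ∃ (c : ℕ → X) (P Q : ℕ → Set X), (∀ j, IsCutOn N (c j) (P j) (Q j)) ∧ (∀ j, a ∈ P j) ∧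
      (∀ j, b ∈ Q j) ∧ (∀ j, N \ Q j ⊆ P (j + 1)) := by
  choose C P Q hC hP hQ using fun x : {x : X // x ∈ N ∧ x ≠ b} => hsep x x.2.1 b hb x.2.2
  let step : {x : X // x ∈ N ∧ x ≠ b} → {x : X // x ∈ N ∧ x ≠ b} := fun x =>
    ⟨C x, (hC x).mem, by
      rintro h
      exact (hC x).symm.notMem_point (h ▸ hQ x)⟩
  let s : ℕ → {x : X // x ∈ N ∧ x ≠ b} := fun j => step^[j] ⟨a, ha, hab⟩
  have hs : ∀ j, (s (j + 1) : X) = C (s j) := fun j => by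
    simp only [s, Function.iterate_succ_apply', step]
  have hsub : ∀ j, N \ Q (s j) ⊆ P (s (j + 1)) := fun j =>
    (hC (s j)).sdiff_subset_of_mem (hC (s (j + 1))) hN (hs j ▸ hP (s (j + 1))) hb (hQ _) (hQ _)
  refine ⟨fun j => C (s j), fun j => P (s j), fun j => Q (s j), fun j => hC _, fun j => ?_,
    fun j => hQ _, hsub⟩
  induction j with
  | zero => exact hP _
  | succ j ih => exact hsub j ⟨ha, (hC (s j)).notMem a ha ih⟩

theorem IsLocalDendrite.exists_disjoint_finite_frontier {X : Type*} [MetricSpace X] [CompactSpace X]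
    (hX : IsLocalDendrite X) {𝒰 : Ultrafilter ℕ} {D : ℕ → Set X} (hDo : ∀ i, IsOpen (D i))
    (hD : ∀ i, IsPreconnected (D i)) {z w : ℕ → X} (hz : ∀ i, z i ∈ D i) (hw : ∀ i, w i ∈ D i)
    {ε : ℝ} (hε : 0 < ε) (hzw : ∀ i, ε ≤ dist (z i) (w i)) :
    ∃ W₁ W₂ B : Set X, IsOpen W₁ ∧ IsOpen W₂ ∧ W₁.Nonempty ∧ W₂.Nonempty ∧
      (∀ y ∈ W₁, y ∉ W₂) ∧ B.Finite ∧ frontier W₁ ⊆ B ∧ frontier W₂ ⊆ B ∧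
      ∀ b ∈ B, ∀ᶠ i in 𝒰, b ∈ D i := by
  have hlc := hX.locallyConnectedSpace
  obtain ⟨a, -, ha⟩ := isCompact_univ.ultrafilter_le_nhds (𝒰.map z) (by simp)
  have hza : Tendsto z 𝒰 (𝓝 a) := ha
  obtain ⟨N, hN, hNp, hsep⟩ := hX.exists_nhds_separating a
  obtain ⟨U, hU, haU, hcl, hfin⟩ := hX.exists_isOpen_finite_frontier
    (inter_mem (interior_mem_nhds.2 hN) (Metric.ball_mem_nhds a (half_pos hε)))
  have hclN : closure U ⊆ N := fun y hy => interior_subset (hcl hy).1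
  set E : ℕ → Set X := fun i => connectedComponentIn (D i ∩ U) (z i)
  have hEDU : ∀ i, E i ⊆ D i ∩ U := fun i => connectedComponentIn_subset _ _
  have hy : ∀ᶠ i in 𝒰, ∃ b ∈ frontier U, b ∈ D i ∧ b ∈ closure (E i) := by
    filter_upwards [hza (hU.mem_nhds haU)] with i hi
    have hzE : z i ∈ E i := mem_connectedComponentIn ⟨hz i, hi⟩
    obtain ⟨y, hyD, hyE⟩ := (hD i).inter_frontier_nonempty_of_not_subset
      (((hDo i).inter hU).connectedComponentIn (x := z i)) ⟨z i, hz i, hzE⟩ fun hsub => by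
        have h1 := (hcl (subset_closure (hEDU i (hsub (hw i))).2)).2
        have h2 := (hcl (subset_closure hi)).2
        rw [Metric.mem_ball] at h1 h2
        linarith [hzw i, dist_triangle_right (z i) (w i) a]
    refine ⟨y, ⟨closure_mono (fun v hv => (hEDU i hv).2) hyE.1, ?_⟩, hyD, hyE.1⟩
    rw [hU.interior_eq]
    intro hyU
    refine hyE.2 ?_
    rw [(((hDo i).inter hU).connectedComponentIn (x := z i)).interior_eq]
    exact mem_connectedComponentIn_of_mem_closure ⟨hz i, hi⟩ hyE.1 ⟨hyD, hyU⟩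
  obtain ⟨b, hbU, hb⟩ := (Ultrafilter.eventually_exists_mem_iff hfin).1 hy
  have hbU' : b ∉ U := by
    have := hbU.2
    rwa [hU.interior_eq] at this
  obtain ⟨c, P, Q, hcut, haP, hbQ, hPQ⟩ := exists_seq_isCutOn hNp (fun x hx y hy hxy => by
    obtain ⟨c, hc, P, Q, hP, hQ, hd, hm, h1, h2⟩ := hsep x hx y hy hxy
    exact ⟨c, P, Q, ⟨hc, hP, hQ, hd, hm⟩, h1, h2⟩) (mem_of_mem_nhds hN) (hclN hbU.1)
    (by rintro rfl; exact hbU' haU)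
  have hcb : ∀ j, c j ≠ b := by
    intro j h
    exact (hcut j).symm.notMem_point (h ▸ hbQ j)
  have hcA : ∀ j, ∀ᶠ i in 𝒰, c j ∈ E i ∩ D i := by
    intro j
    filter_upwards [hb, hza (hU.mem_nhds haU), hza ((hcut j).isOpen.mem_nhds (haP j))]
      with i hbi hi hiP
    have hzE : z i ∈ E i := mem_connectedComponentIn ⟨hz i, hi⟩
    have hA : IsPreconnected (insert b (E i)) :=
      isPreconnected_connectedComponentIn.subset_closure (subset_insert _ _)
        (insert_subset hbi.2 subset_closure)
    have := (hcut j).mem_of_isPreconnected hA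
      (insert_subset (hclN hbU.1) fun y hy => hclN (subset_closure (hEDU i hy).2))
      ⟨z i, mem_insert_of_mem _ hzE, hiP⟩ ⟨b, mem_insert _ _, hbQ j⟩
    have := this.resolve_left (hcb j)
    exact ⟨this, (hEDU i this).1⟩
  have hcU : ∀ j, c j ∈ U := fun j => by
    obtain ⟨i, hi⟩ := (hcA j).exists
    exact (hEDU i hi.1).2
  have hcP : ∀ j, c j ∈ P (j + 1) := fun j => hPQ j ⟨(hcut j).mem, (hcut j).symm.notMem_point⟩
  set W : ℕ → Set X := fun j => Q j ∩ P (j + 1)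
  have hQanti : ∀ j k, j ≤ k → N ∩ Q k ⊆ Q j := by
    intro j k hjk
    induction k, hjk using Nat.le_induction with
    | base => exact inter_subset_right
    | succ k hk ih =>
      intro y hy
      by_contra hyj
      have : y ∉ Q k := fun h => hyj (ih ⟨hy.1, h⟩)
      exact (hcut (k + 1)).notMem y hy.1 (hPQ k ⟨hy.1, this⟩) hy.2
  have hdisj : ∀ j k, j < k → ∀ y ∈ N, y ∈ W j → y ∉ W k := fun j k hjk y hyN h1 h2 =>
    (hcut (j + 1)).notMem y hyN h1.2 (hQanti (j + 1) k hjk ⟨hyN, h2.1⟩)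
  have hbad : {j | (W j ∩ frontier U).Nonempty}.Finite := by
    refine (hfin.biUnion (t := fun y => {j | y ∈ W j}) fun y hy =>
      Set.Subsingleton.finite fun j hj k hk => ?_).subset ?_
    · have hyN := hclN hy.1
      rcases lt_trichotomy j k with h | h | h
      · exact (hdisj j k h y hyN hj hk).elim
      · exact h
      · exact (hdisj k j h y hyN hk hj).elim
    · rintro j ⟨y, hy, hyU⟩
      exact mem_biUnion hyU hy
  have hWo : ∀ j, IsOpen (W j ∩ U) := fun j => ((hcut j).isOpen'.inter (hcut (j + 1)).isOpen).inter hU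
  have hWne : ∀ j, (W j ∩ U).Nonempty := by
    intro j
    obtain ⟨y, hy, hyN, hyQ⟩ := mem_closure_iff.1
      ((hcut j).point_mem_closure hNp ⟨b, hclN hbU.1, hbQ j⟩) _ (hU.inter (hcut (j + 1)).isOpen)
      ⟨hcU j, hcP j⟩
    exact ⟨y, ⟨hyQ, hy.2⟩, hy.1⟩
  have hWf : ∀ j, ¬ (W j ∩ frontier U).Nonempty → frontier (W j ∩ U) ⊆ {c j, c (j + 1)} := by
    rintro j hj y ⟨hy, hyW⟩
    rw [(hWo j).interior_eq] at hyW
    have hyU : y ∈ closure U := closure_mono inter_subset_right hy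
    by_contra hne
    rw [mem_insert_iff, mem_singleton_iff, not_or] at hne
    have hyQ : y ∈ Q j := by
      refine (((hcut j).mem_iff y (hclN hyU)).2 hne.1).resolve_left fun hyP => ?_
      obtain ⟨v, hv, hvW⟩ := mem_closure_iff.1 hy _ ((hcut j).isOpen.inter isOpen_interior)
        ⟨hyP, (hcl hyU).1⟩
      exact (hcut j).notMem v (interior_subset hv.2) hv.1 hvW.1.1
    have hyP : y ∈ P (j + 1) := by
      refine (((hcut (j + 1)).mem_iff y (hclN hyU)).2 hne.2).resolve_right fun hyQ => ?_
      obtain ⟨v, hv, hvW⟩ := mem_closure_iff.1 hy _ ((hcut (j + 1)).isOpen'.inter isOpen_interior)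
        ⟨hyQ, (hcl hyU).1⟩
      exact (hcut (j + 1)).notMem v (interior_subset hv.2) hvW.1.2 hv.1
    have hyU' : y ∉ U := fun h => hyW ⟨⟨hyQ, hyP⟩, h⟩
    exact hj ⟨y, ⟨hyQ, hyP⟩, hyU, by rwa [hU.interior_eq]⟩
  obtain ⟨j, hj⟩ := hbad.infinite_compl.nonempty
  obtain ⟨k, hk, hjk⟩ := hbad.infinite_compl.exists_gt j
  refine ⟨W j ∩ U, W k ∩ U, {c j, c (j + 1)} ∪ {c k, c (k + 1)}, hWo j, hWo k, hWne j, hWne k,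
    fun y h1 h2 => hdisj j k hjk y (hclN (subset_closure h1.2)) h1.1 h2.1, by simp [Set.toFinite],
    (hWf j hj).trans subset_union_left, (hWf k hk).trans subset_union_right, ?_⟩
  rintro y ((rfl | rfl) | (rfl | rfl)) <;> exact (hcA _).mono fun i hi => hi.2

/-- Along the ultrafilter `𝒰`, the images `φ i (S i)` shrink to the point `x`. -/
def ShrinksTo {X : Type*} [TopologicalSpace X] (𝒰 : Ultrafilter ℕ) (φ : ℕ → X ≃ₜ X)
    (S : ℕ → Set X) (x : X) : Prop :=
  ∀ V ∈ 𝓝 x, ∀ᶠ i in 𝒰, ∀ y ∈ S i, φ i y ∈ V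

namespace ShrinksTo

variable {X : Type*} [TopologicalSpace X] {𝒰 : Ultrafilter ℕ} {φ : ℕ → X ≃ₜ X} {S T : ℕ → Set X}
  {x y : X}

theorem mono (h : ShrinksTo 𝒰 φ S x) (hTS : ∀ᶠ i in 𝒰, T i ⊆ S i) : ShrinksTo 𝒰 φ T x :=
  fun V hV => by filter_upwards [h V hV, hTS] with i hi hi' y hy using hi y (hi' hy)

theorem tendsto (h : ShrinksTo 𝒰 φ S x) (hy : ∀ᶠ i in 𝒰, y ∈ S i) :
    Tendsto (fun i => φ i y) 𝒰 (𝓝 x) :=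
  fun V hV => by
    have : ∀ᶠ i in 𝒰, φ i y ∈ V := by filter_upwards [h V hV, hy] with i hi hi' using hi y hi'
    exact this

theorem comp (h : ShrinksTo 𝒰 φ S x) (k : X ≃ₜ X) : ShrinksTo 𝒰 (fun i => k * φ i) S (k x) :=
  fun V hV => by
    filter_upwards [h (k ⁻¹' V) (k.continuous.continuousAt hV)] with i hi y hy
    rw [Homeomorph.mul_apply]
    exact hi y hy

theorem exists_pow {g : X ≃ₜ X} {n : ℕ → ℕ} (h : ShrinksTo 𝒰 (fun i => g ^ n i) S x) {m : ℕ}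
    (hm : 1 ≤ m) :
    ∃ (q : ℕ → ℕ) (r : ℕ), ShrinksTo 𝒰 (fun i => (g ^ m) ^ q i) S ((g ^ r)⁻¹ x) := by
  have h1 : ∀ᶠ i in 𝒰, ∃ r ∈ Set.Iio m, n i % m = r :=
    Eventually.of_forall fun i => ⟨_, Nat.mod_lt _ (by omega), rfl⟩
  obtain ⟨r, -, hr⟩ := (Ultrafilter.eventually_exists_mem_iff (Set.finite_Iio m)).1 h1
  refine ⟨fun i => n i / m, r, fun V hV => ?_⟩
  filter_upwards [h.comp (g ^ r)⁻¹ V hV, hr] with i hi hir y hy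
  have := hi y hy
  rwa [← Nat.mod_add_div (n i) m, hir, pow_add, inv_mul_cancel_left, pow_mul] at this

end ShrinksTo

/-- In a locally connected compact metric space, a compact subset of a connected open set is
contained in a connected compact subset. -/
theorem IsCompact.exists_isPreconnected_between {X : Type*} [MetricSpace X] [CompactSpace X]
    [LocallyConnectedSpace X] {K G : Set X} (hK : IsCompact K) (hG : IsOpen G)
    (hGc : IsPreconnected G) (hKG : K ⊆ G) :
    ∃ T, IsCompact T ∧ IsPreconnected T ∧ K ⊆ T ∧ T ⊆ G := by
  rcases G.eq_empty_or_nonempty with rfl | ⟨a, ha⟩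
  · exact ⟨∅, isCompact_empty, isPreconnected_empty, hKG, subset_rfl⟩
  have := locallyPathConnectedSpace_of_compactSpace X
  have hpath : IsPathConnected G := hG.isConnected_iff_isPathConnected.1 ⟨⟨a, ha⟩, hGc⟩
  have h : ∀ y : G, ∃ C T : Set X, IsOpen C ∧ y.1 ∈ C ∧ C ⊆ T ∧ IsCompact T ∧ IsPreconnected T ∧
      a ∈ T ∧ T ⊆ G := by
    rintro ⟨y, hy⟩
    obtain ⟨ε, hε, hball⟩ := Metric.nhds_basis_closedBall.mem_iff.1 (hG.mem_nhds hy)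
    obtain ⟨C, hCs, hCo, hyC, hCc⟩ := locallyConnectedSpace_iff_subsets_isOpen_isConnected.1
      ‹_› y _ (Metric.ball_mem_nhds y hε)
    have hCl : closure C ⊆ G :=
      (closure_mono hCs).trans (Metric.closure_ball_subset_closedBall.trans hball)
    obtain ⟨γ, hγ⟩ := hpath.joinedIn a ha y hy
    refine ⟨C, closure C ∪ range γ, hCo, hyC, subset_closure.trans subset_union_left,
      isClosed_closure.isCompact.union (isCompact_range γ.continuous), ?_,
      Or.inr ⟨0, γ.source⟩, union_subset hCl (range_subset_iff.2 hγ)⟩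
    exact hCc.isPreconnected.closure.union y (subset_closure hyC) ⟨1, γ.target⟩
      (isPreconnected_range γ.continuous)
  choose C T hC hyC hCT hT hTp haT hTG using h
  obtain ⟨t, ht⟩ := hK.elim_finite_subcover C hC fun y hy => mem_iUnion.2 ⟨⟨y, hKG hy⟩, hyC _⟩
  refine ⟨⋃ y ∈ t, T y, t.finite_toSet.isCompact_biUnion fun y _ => hT y, ?_,
    ht.trans (iUnion₂_mono fun y _ => hCT y), iUnion₂_subset fun y _ => hTG y⟩
  rw [← Finset.set_biUnion_coe, ← sUnion_image]
  refine isPreconnected_sUnion a _ ?_ ?_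
  · rintro _ ⟨y, -, rfl⟩
    exact haT y
  · rintro _ ⟨y, -, rfl⟩
    exact hTp y

theorem shrinksTo_or_of_frontier {X : Type*} [MetricSpace X] [CompactSpace X]
    [LocallyConnectedSpace X] {𝒰 : Ultrafilter ℕ} {φ : ℕ → X ≃ₜ X} {G W₁ W₂ B : Set X} {x : X}
    (hG : IsOpen G) (hGc : IsPreconnected G) (hx : x ∉ G) (hGx : closure G ⊆ insert x G)
    (hW₁ : IsOpen W₁) (hd : ∀ y ∈ W₁, y ∉ W₂) (hB : B.Finite)
    (hB₁ : frontier W₁ ⊆ B)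
    (hBx : ∀ b ∈ B, Tendsto (fun i => φ i b) 𝒰 (𝓝 x))
    (h₁ : ∀ᶠ i in 𝒰, ∀ y ∈ W₁, φ i y ∈ insert x G)
    (h₂ : ∀ᶠ i in 𝒰, ∀ y ∈ W₂, φ i y ∈ insert x G) :
    ShrinksTo 𝒰 φ (fun _ => W₁) x ∨ ShrinksTo 𝒰 φ (fun _ => W₂) x := by
  have key : ∀ V ∈ 𝓝 x, ∀ᶠ i in 𝒰, (∀ y ∈ W₁, φ i y ∈ V) ∨ ∀ y ∈ W₂, φ i y ∈ V := by
    intro V hV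
    have hcl : IsClosed (insert x G) := isClosed_of_closure_subset (by
      rw [insert_eq, closure_union, closure_singleton]
      exact union_subset (by simp) (hGx.trans (by rw [insert_eq])))
    obtain ⟨T, hTk, hTp, hKT, hTG⟩ := (hcl.sdiff (isOpen_interior (s := V))).isCompact
      |>.exists_isPreconnected_between hG hGc (by
        rintro y ⟨rfl | hy, hyV⟩
        · exact (hyV (mem_interior_iff_mem_nhds.2 hV)).elim
        · exact hy)
    have hT : Tᶜ ∈ 𝓝 x := hTk.isClosed.isOpen_compl.mem_nhds fun h => hx (hTG h)
    have hBT : ∀ᶠ i in 𝒰, ∀ b ∈ B, φ i b ∈ Tᶜ :=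
      (eventually_all_finite hB).2 fun b hb => hBx b hb hT
    filter_upwards [hBT, h₁, h₂] with i hiB hi₁ hi₂
    have hsub : (∃ y ∈ W₁, φ i y ∈ T) → T ⊆ φ i '' W₁ := by
      rintro ⟨y, hy, hyT⟩
      refine hTp.subset_of_disjoint_frontier ((φ i).isOpenMap W₁ hW₁) ⟨_, hyT, ⟨y, hy, rfl⟩⟩ ?_
      rw [← (φ i).image_frontier, disjoint_right]
      rintro _ ⟨b, hb, rfl⟩
      exact hiB b (hB₁ hb)
    have hV : ∀ y ∈ insert x G, y ∉ T → y ∈ V := fun y hy hyT => by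
      by_contra hyV
      exact hyT (hKT ⟨hy, fun h => hyV (interior_subset h)⟩)
    by_cases he : ∃ y ∈ W₁, φ i y ∈ T
    · refine Or.inr fun y hy => hV _ (hi₂ y hy) fun hyT => ?_
      obtain ⟨v, hv, hvy⟩ := hsub he hyT
      obtain rfl := (φ i).injective hvy
      exact hd v hv hy
    · push Not at he
      exact Or.inl fun y hy => hV _ (hi₁ y hy) (he y hy)
  by_contra! hne
  obtain ⟨h1, h2⟩ := hne
  simp only [ShrinksTo, not_forall] at h1 h2
  obtain ⟨V₁, hV₁, h1⟩ := h1
  obtain ⟨V₂, hV₂, h2⟩ := h2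
  rcases Ultrafilter.eventually_or.1 (key _ (inter_mem hV₁ hV₂)) with h | h
  · exact h1 (h.mono fun i hi y hy => (hi y hy).1)
  · exact h2 (h.mono fun i hi y hy => (hi y hy).2)

/-- Without wandering points, iterates of a homeomorphism of a local dendrite cannot shrink an open
set to a point. -/
theorem Homeomorph.Nonwandering.not_shrinksTo {X : Type*} [MetricSpace X] [CompactSpace X]
    [ConnectedSpace X] [Nontrivial X] (hX : IsLocalDendrite X) {h : X ≃ₜ X} (hh : h.Nonwandering)
    {𝒰 : Ultrafilter ℕ} {n : ℕ → ℕ} {W : Set X} {x : X} (hW : IsOpen W) (hne : W.Nonempty)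
    (hs : ShrinksTo 𝒰 (fun i => h ^ n i) (fun _ => W) x) : False := by
  have hlc := hX.locallyConnectedSpace
  obtain ⟨m, hm, y, hy, hy'⟩ := hh W hW hne
  obtain ⟨q, r, hq⟩ := hs.exists_pow hm
  set K := h ^ m
  have hK : K.Nonwandering := hh.pow hm
  set x' := (h ^ r)⁻¹ x
  have hKx : K x' = x' := by
    refine tendsto_nhds_unique ((hq.comp K).tendsto (y := y) (.of_forall fun _ => hy)) ?_
    refine (hq.tendsto (y := K y) (.of_forall fun _ => hy')).congr fun i => ?_
    rw [← Homeomorph.mul_apply, ← pow_succ, ← pow_succ']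
  obtain ⟨v, hvW, hvx⟩ : ∃ v ∈ W, v ≠ x' := by
    by_contra! hall
    have hWx : W = {x'} := Subset.antisymm hall (by
      obtain ⟨v, hv⟩ := hne
      rw [← hall v hv]
      exact singleton_subset_iff.2 hv)
    have := IsClopen.eq_univ ⟨isClosed_singleton, hWx ▸ hW⟩ (singleton_nonempty x')
    obtain ⟨u, hu⟩ := exists_ne x'
    exact hu (this.symm ▸ mem_univ u : u ∈ ({x'} : Set X))
  obtain ⟨A, A', hA, hA', hvA, hxA', hAA⟩ := t2_separation hvx
  set W' := connectedComponentIn (W ∩ A) v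
  have hW'o : IsOpen W' := (hW.inter hA).connectedComponentIn
  have hW's : W' ⊆ W ∩ A := connectedComponentIn_subset _ _
  have hvW' : v ∈ W' := mem_connectedComponentIn ⟨hvW, hvA⟩
  have hW'p : IsPreconnected W' := isPreconnected_connectedComponentIn
  obtain ⟨m', hm', u, hu, hu'⟩ := hK W' hW'o ⟨v, hvW'⟩
  obtain ⟨s, r', hs'⟩ := (hq.mono (T := fun _ => W')
    (.of_forall fun _ => hW's.trans inter_subset_left)).exists_pow hm'
  set k := K ^ m'
  have hk : k.Nonwandering := hK.pow hm'
  rw [(Homeomorph.inv_apply_eq_iff' (K ^ r')).2 (Homeomorph.pow_apply_eq_self hKx r').symm] at hs'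
  have hkx : k x' = x' := Homeomorph.pow_apply_eq_self hKx m'
  obtain ⟨V, hV, hxV, hVA, hVf⟩ := hX.exists_isOpen_finite_frontier (hA'.mem_nhds hxA')
  have hVW : ∀ y ∈ W', y ∉ V := fun y hy hyV =>
    hAA.notMem_of_mem_left (hW's hy).2 (hVA (subset_closure hyV))
  have hexit : ∀ᶠ i in 𝒰, ∃ b ∈ frontier V, ∃ l, 1 ≤ l ∧
      (∀ j < l, ∀ y ∈ W', (k ^ (j + s i)) y ∈ V) ∧ ∃ w ∈ W', (k ^ (l + s i)) w = b := by
    filter_upwards [hs' V (hV.mem_nhds hxV)] with i hi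
    have hex : ∃ l, ¬ ∀ y ∈ W', (k ^ (l + s i)) y ∈ V := by
      obtain ⟨n, hn, y, hy, hy'⟩ := hk.exists_return_ge hW'o ⟨v, hvW'⟩ (s i)
      refine ⟨n - s i, fun hall => hVW _ hy' ?_⟩
      have := hall y hy
      rwa [Nat.sub_add_cancel hn] at this
    classical
    have hl := Nat.find_spec hex
    have hmin : ∀ j < Nat.find hex, ∀ y ∈ W', (k ^ (j + s i)) y ∈ V := fun j hj =>
      not_not.1 (Nat.find_min hex hj)
    set l := Nat.find hex
    have hl0 : 1 ≤ l := by
      rw [Nat.one_le_iff_ne_zero]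
      intro h0
      rw [h0, zero_add] at hl
      exact hl hi
    obtain ⟨b, ⟨w, hw, hwb⟩, hb⟩ := (hW'p.image (k ^ (l + s i))
      (k ^ (l + s i)).continuous.continuousOn).inter_frontier_nonempty_of_not_subset hV
      ⟨(k ^ (l + s i)) u, ⟨u, hu, rfl⟩, by
        have := hmin (l - 1) (by omega) _ hu'
        rwa [← Homeomorph.mul_apply, ← pow_succ, show l - 1 + s i + 1 = l + s i by omega] at this⟩
      (fun hsub => hl fun y hy => hsub ⟨y, hy, rfl⟩)
    exact ⟨b, hb, l, hl0, hmin, w, hw, hwb⟩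
  obtain ⟨b, hbV, hb⟩ := (Ultrafilter.eventually_exists_mem_iff hVf).1 hexit
  have hbV' : b ∉ V := by
    have := hbV.2
    rwa [hV.interior_eq] at this
  obtain ⟨i₀, l₀, hl₀, -, w₀, hw₀, hwb₀⟩ := hb.exists
  have hstay : ∀ᶠ i in 𝒰, ∀ j ∈ Set.Iic (l₀ + s i₀), ∀ y ∈ W', (k ^ (j + s i)) y ∈ V := by
    refine (eventually_all_finite (Set.finite_Iic _)).2 fun j _ => ?_
    have := hs'.comp (k ^ j)
    rw [Homeomorph.pow_apply_eq_self hkx] at this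
    filter_upwards [this V (hV.mem_nhds hxV)] with i hi y hy
    rw [pow_add]
    exact hi y hy
  obtain ⟨i, ⟨l, -, hmin, w, hw, hwb⟩, hi⟩ := (hb.and hstay).exists
  have hlt : l₀ + s i₀ < l := by
    by_contra hle
    exact hbV' (hwb ▸ hi l (by simpa using hle) w hw)
  have heq : w₀ = (k ^ (l - (l₀ + s i₀) + s i)) w := by
    refine (k ^ (l₀ + s i₀)).injective ?_
    rw [← Homeomorph.pow_add_apply, hwb₀, ← hwb]
    congr 2
    omega
  exact hVW w₀ hw₀ (heq ▸ hmin _ (by omega) w hw)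

theorem exists_isCut_of_not_isPreconnected {X : Type*} [TopologicalSpace X] [T1Space X] {x : X}
    (h : ¬ IsPreconnected ({x}ᶜ : Set X)) : ∃ G G', IsCut x G G' := by
  simp only [IsPreconnected, not_forall] at h
  obtain ⟨u, v, hu, hv, hc, ⟨a, ha, hau⟩, ⟨b, hb, hbv⟩, hne⟩ := h
  refine ⟨{x}ᶜ ∩ u, {x}ᶜ ∩ v, isOpen_compl_singleton.inter hu, isOpen_compl_singleton.inter hv,
    fun y h1 h2 => hne ⟨y, h1.1, h1.2, h2.2⟩, fun y => ⟨?_, fun hy => ?_⟩, ⟨a, ha, hau⟩, ⟨b, hb, hbv⟩⟩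
  · rintro (h | h) <;> exact h.1
  · exact (hc hy).imp (fun h => ⟨hy, h⟩) fun h => ⟨hy, h⟩

section

variable {X : Type*} [MetricSpace X] [CompactSpace X] [ConnectedSpace X] {𝒰 : Ultrafilter ℕ}
  {D : ℕ → Set X} {n : ℕ → ℕ} {z w : ℕ → X} {x : X} {ε : ℝ}

theorem Homeomorph.Nonwandering.not_shrinksTo_of_notMem (hX : IsLocalDendrite X) {h : X ≃ₜ X}
    (hh : h.Nonwandering) (hx : h x = x) (hDo : ∀ i, IsOpen (D i)) (hD : ∀ i, IsPreconnected (D i))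
    (hz : ∀ i, z i ∈ D i) (hw : ∀ i, w i ∈ D i) (hε : 0 < ε) (hzw : ∀ i, ε ≤ dist (z i) (w i))
    (hxD : ∀ i, x ∉ D i) : ¬ ShrinksTo 𝒰 (fun i => h ^ n i) D x := by
  intro hs
  have hlc := hX.locallyConnectedSpace
  have : Nontrivial X := ⟨z 0, w 0, dist_pos.1 (hε.trans_le (hzw 0))⟩
  obtain ⟨W₁, W₂, B, hW₁, hW₂, ⟨a₁, ha₁⟩, ⟨a₂, ha₂⟩, hd, hB, hB₁, hB₂, hBD⟩ :=
    hX.exists_disjoint_finite_frontier (𝒰 := 𝒰) hDo hD hz hw hε hzw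
  obtain ⟨b₁, hb₁⟩ : (frontier W₁).Nonempty :=
    nonempty_frontier_iff.2 ⟨⟨a₁, ha₁⟩, fun he => hd a₂ (he ▸ mem_univ a₂) ha₂⟩
  obtain ⟨b₂, hb₂⟩ : (frontier W₂).Nonempty :=
    nonempty_frontier_iff.2 ⟨⟨a₂, ha₂⟩, fun he => hd a₁ ha₁ (he ▸ mem_univ a₁)⟩
  have hbx : ∀ b ∈ B, b ≠ x := by
    rintro b hb rfl
    obtain ⟨i, hi⟩ := (hBD b hb).exists
    exact hxD i hi
  set Q := connectedComponentIn {x}ᶜ b₁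
  have hb₁Q : b₁ ∈ Q := mem_connectedComponentIn (hbx b₁ (hB₁ hb₁))
  have hQo : IsOpen Q := isOpen_compl_singleton.connectedComponentIn
  have hQp : IsPreconnected Q := isPreconnected_connectedComponentIn
  have hQx : Q ⊆ {x}ᶜ := connectedComponentIn_subset _ _
  have hQcl : closure Q ⊆ insert x Q := fun y hy => by
    by_cases hyx : y = x
    · exact Or.inl hyx
    · exact Or.inr (mem_connectedComponentIn_of_mem_closure (hbx b₁ (hB₁ hb₁)) hy hyx)
  have hBQ : B ⊆ Q := by
    intro b hb
    obtain ⟨i, hi, hi₁⟩ := ((hBD b hb).and (hBD b₁ (hB₁ hb₁))).exists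
    exact (hD i).subset_connectedComponentIn hi₁ (fun y hy (hyx : y = x) => hxD i (hyx ▸ hy)) hi
  obtain ⟨s, hs1, y, hy, hy'⟩ := hh Q hQo ⟨b₁, hb₁Q⟩
  obtain ⟨t, r, ht⟩ := hs.exists_pow hs1
  rw [(Homeomorph.inv_apply_eq_iff' (h ^ r)).2 (Homeomorph.pow_apply_eq_self hx r).symm] at ht
  have hk : (h ^ s).Nonwandering := hh.pow hs1
  have hkx : (h ^ s) x = x := Homeomorph.pow_apply_eq_self hx s
  set k := h ^ s
  have hkQ : ∀ v ∈ Q, k v ∈ Q := by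
    intro v hv
    have hsub : k '' Q ⊆ Q := by
      have := (hQp.image k k.continuous.continuousOn).subset_connectedComponentIn
        (F := {x}ᶜ) (mem_image_of_mem k hy) (by
          rintro _ ⟨u, hu, rfl⟩ hux
          exact hQx hu (k.injective (Eq.trans hux hkx.symm)))
      rwa [← connectedComponentIn_eq hy'] at this
    exact hsub ⟨v, hv, rfl⟩
  have hkQ' : ∀ j, ∀ v ∈ Q, (k ^ j) v ∈ Q := by
    intro j v hv
    induction j with
    | zero => exact hv
    | succ j ih =>
      rw [pow_succ', Homeomorph.mul_apply]
      exact hkQ _ ih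
  have hne : ∀ W b, b ∈ frontier W → b ∈ B → (W ∩ Q).Nonempty := by
    intro W b hb hbB
    obtain ⟨v, hvQ, hvW⟩ := mem_closure_iff.1 hb.1 Q hQo (hBQ hbB)
    exact ⟨v, hvW, hvQ⟩
  have hfr : frontier (W₁ ∩ Q) ⊆ insert x B := by
    refine (frontier_inter_subset _ _).trans (union_subset (inter_subset_left.trans
      (hB₁.trans (subset_insert _ _))) (inter_subset_right.trans fun y hy => ?_))
    have := hy.2
    rw [hQo.interior_eq] at this
    exact Or.inl ((hQcl hy.1).resolve_right this)
  have hBx : ∀ b ∈ insert x B, Tendsto (fun i => (k ^ t i) b) 𝒰 (𝓝 x) := by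
    rintro b (rfl | hb)
    · simp only [Homeomorph.pow_apply_eq_self hkx]
      exact tendsto_const_nhds
    · exact ht.tendsto (hBD b hb)
  rcases shrinksTo_or_of_frontier (𝒰 := 𝒰) (φ := fun i => k ^ t i) (W₁ := W₁ ∩ Q) (W₂ := W₂ ∩ Q)
    (B := insert x B) hQo hQp (fun h => hQx h rfl) hQcl (hW₁.inter hQo)
    (fun y h1 h2 => hd y h1.1 h2.1) (hB.insert x) hfr hBx
    (.of_forall fun i y hy => Or.inr (hkQ' _ y hy.2))
    (.of_forall fun i y hy => Or.inr (hkQ' _ y hy.2)) with hW | hW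
  · exact hk.not_shrinksTo hX (hW₁.inter hQo) (hne W₁ b₁ hb₁ (hB₁ hb₁)) hW
  · exact hk.not_shrinksTo hX (hW₂.inter hQo) (hne W₂ b₂ hb₂ (hB₂ hb₂)) hW

theorem Homeomorph.Nonwandering.not_shrinksTo_of_fixed (hX : IsLocalDendrite X) {h : X ≃ₜ X}
    (hh : h.Nonwandering) (hx : h x = x) (hDo : ∀ i, IsOpen (D i)) (hD : ∀ i, IsPreconnected (D i))
    (hz : ∀ i, z i ∈ D i) (hw : ∀ i, w i ∈ D i) (hε : 0 < ε) (hzw : ∀ i, ε ≤ dist (z i) (w i)) :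
    ¬ ShrinksTo 𝒰 (fun i => h ^ n i) D x := by
  intro hs
  have hlc := hX.locallyConnectedSpace
  have h1 : ∀ i, ∃ v ∈ D i, ε / 2 ≤ dist v x := by
    intro i
    by_contra! hall
    linarith [hall _ (hz i), hall _ (hw i), hzw i, dist_triangle_right (z i) (w i) x]
  choose v hvD hv using h1
  have hvx : ∀ i, v i ∈ D i \ {x} := fun i => ⟨hvD i, by
    rintro rfl
    have := hv i
    rw [dist_self] at this
    linarith⟩
  have hCo : ∀ i, IsOpen (connectedComponentIn (D i \ {x}) (v i)) := fun i =>
    ((hDo i).sdiff isClosed_singleton).connectedComponentIn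
  have hCs : ∀ i, connectedComponentIn (D i \ {x}) (v i) ⊆ D i \ {x} := fun i =>
    connectedComponentIn_subset _ _
  have h2 : ∀ i, ∃ u ∈ connectedComponentIn (D i \ {x}) (v i), ε / 4 ≤ dist (v i) u := by
    intro i
    by_cases hxD : x ∈ D i
    · obtain ⟨y, hyD, hyC⟩ := (hD i).inter_frontier_nonempty_of_not_subset (hCo i)
        ⟨v i, hvD i, mem_connectedComponentIn (hvx i)⟩ fun hsub => (hCs i (hsub hxD)).2 rfl
      have hyx : y = x := by
        by_contra hyx
        refine hyC.2 ?_
        rw [(hCo i).interior_eq]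
        exact mem_connectedComponentIn_of_mem_closure (hvx i) hyC.1 ⟨hyD, hyx⟩
      subst hyx
      obtain ⟨u, hu, huy⟩ := Metric.mem_closure_iff.1 hyC.1 (ε / 4) (by linarith)
      refine ⟨u, hu, ?_⟩
      have h3 := dist_triangle (v i) u y
      rw [dist_comm u y] at h3
      linarith [hv i]
    · rw [sdiff_singleton_eq_self hxD, (hD i).connectedComponentIn (hvD i)]
      by_contra! hall
      linarith [hall _ (hz i), hall _ (hw i), hzw i, dist_triangle_left (z i) (w i) (v i)]
  choose u hu hvu using h2
  exact hh.not_shrinksTo_of_notMem hX hx hCo (fun i => isPreconnected_connectedComponentIn)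
    (fun i => mem_connectedComponentIn (hvx i)) hu (by linarith) hvu
    (fun i hi => (hCs i hi).2 rfl) (hs.mono (.of_forall fun i => (hCs i).trans sdiff_subset))

/-- Without wandering points, iterates of a homeomorphism of a local dendrite cannot shrink large
connected open sets to a point. -/
theorem Homeomorph.Nonwandering.not_shrinksTo_of_le_dist (hX : IsLocalDendrite X) {g : X ≃ₜ X}
    (hg : g.Nonwandering) (hDo : ∀ i, IsOpen (D i)) (hD : ∀ i, IsPreconnected (D i))
    (hz : ∀ i, z i ∈ D i) (hw : ∀ i, w i ∈ D i) (hε : 0 < ε) (hzw : ∀ i, ε ≤ dist (z i) (w i)) :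
    ¬ ShrinksTo 𝒰 (fun i => g ^ n i) D x := by
  intro hs
  by_cases hc : IsPreconnected ({x}ᶜ : Set X)
  · have hlc := hX.locallyConnectedSpace
    have : Nontrivial X := ⟨z 0, w 0, dist_pos.1 (hε.trans_le (hzw 0))⟩
    obtain ⟨W₁, W₂, B, hW₁, hW₂, hne₁, hne₂, hd, hB, hB₁, -, hBD⟩ :=
      hX.exists_disjoint_finite_frontier (𝒰 := 𝒰) hDo hD hz hw hε hzw
    rcases shrinksTo_or_of_frontier (𝒰 := 𝒰) (φ := fun i => g ^ n i) (x := x)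
      isOpen_compl_singleton hc (by simp) (fun y _ => by simp [em]) hW₁ hd hB hB₁
      (fun b hb => hs.tendsto (hBD b hb)) (.of_forall fun i y _ => by simp [em])
      (.of_forall fun i y _ => by simp [em]) with hW | hW
    · exact hg.not_shrinksTo hX hW₁ hne₁ hW
    · exact hg.not_shrinksTo hX hW₂ hne₂ hW
  · obtain ⟨G, G', hcut⟩ := exists_isCut_of_not_isPreconnected hc
    obtain ⟨m, hm, hmx⟩ := hcut.exists_pow_apply_eq hg
    obtain ⟨q, r, hq⟩ := hs.exists_pow hm
    refine (hg.pow hm).not_shrinksTo_of_fixed hX ?_ hDo hD hz hw hε hzw hq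
    rw [← Homeomorph.mul_apply, (Commute.refl g).pow_pow m r |>.inv_right.eq, Homeomorph.mul_apply,
      hmx]

theorem Homeomorph.Nonwandering.equicontinuous (hX : IsLocalDendrite X) {g : X ≃ₜ X}
    (hg : g.Nonwandering) (hε : 0 < ε) :
    ∃ δ > 0, ∀ x y : X, dist x y < δ → ∀ k, dist ((g ^ k) x) ((g ^ k) y) < ε := by
  by_contra! hne
  have hlc := hX.locallyConnectedSpace
  have h1 : ∀ i : ℕ, ∃ (a b : X) (k : ℕ) (C : Set X), IsOpen C ∧ IsPreconnected C ∧ a ∈ C ∧ b ∈ C ∧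
      C ⊆ Metric.ball a (1 / ((i : ℝ) + 1)) ∧ ε ≤ dist ((g ^ k) a) ((g ^ k) b) := by
    intro i
    obtain ⟨δ, hδ, h⟩ := exists_delta_isPreconnected (X := X) (Nat.one_div_pos_of_nat (α := ℝ) (n := i))
    obtain ⟨a, b, hab, k, hk⟩ := hne δ hδ
    obtain ⟨C, hC, hCp, ha, hb, hCs⟩ := h a b hab
    exact ⟨a, b, k, C, hC, hCp, ha, hb, hCs, hk⟩
  choose a b k C hC hCp ha hb hCs hk using h1
  obtain ⟨x, -, hx⟩ := isCompact_univ.ultrafilter_le_nhds ((hyperfilter ℕ).map a) (by simp)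
  have hax : Tendsto a (hyperfilter ℕ) (𝓝 x) := hx
  refine hg.inv.not_shrinksTo_of_le_dist (𝒰 := hyperfilter ℕ) (D := fun i => (g ^ k i) '' C i)
    (n := k) (x := x) hX (fun i => (g ^ k i).isOpenMap _ (hC i))
    (fun i => (hCp i).image _ (g ^ k i).continuous.continuousOn)
    (fun i => mem_image_of_mem _ (ha i)) (fun i => mem_image_of_mem _ (hb i)) hε hk fun V hV => ?_
  obtain ⟨r, hr, hrV⟩ := Metric.mem_nhds_iff.1 hV
  have h0 : ∀ᶠ i : ℕ in hyperfilter ℕ, 1 / ((i : ℝ) + 1) < r / 2 :=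
    Nat.hyperfilter_le_atTop ((tendsto_one_div_add_atTop_nhds_zero_nat (𝕜 := ℝ)).eventually
      (gt_mem_nhds (half_pos hr)))
  filter_upwards [h0, hax (Metric.ball_mem_nhds x (half_pos hr))] with i hi hi'
  rintro _ ⟨c, hc, rfl⟩
  rw [inv_pow, (g ^ k i).inv_apply_eq_iff'.2 rfl]
  refine hrV ?_
  have h2 := hCs i hc
  rw [Metric.mem_ball] at h2 ⊢
  rw [mem_preimage, Metric.mem_ball] at hi'
  linarith [dist_triangle c (a i) x]

end

theorem Homeomorph.coe_pow_eq_iterate {X : Type*} [TopologicalSpace X] (g : X ≃ₜ X) (n : ℕ) :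
    ⇑(g ^ n) = g^[n] := by
  induction n with
  | zero => rfl
  | succ n ih =>
    rw [pow_succ, Function.iterate_succ, ← ih]
    rfl

/-- a homeomorphism of a local dendrite has polynomial entropy `0` or `1`,
and it equals `1` iff there is a wandering point. -/
theorem hpol_zero_or_one_of_isHomeomorph_of_isLocalDendrite
    {X : Type*} [MetricSpace X] [CompactSpace X] [ConnectedSpace X] [Nonempty X]
    (hX : IsLocalDendrite X) (f : X → X) (hf : IsHomeomorph f) :
    (hpol f = 0 ∨ hpol f = 1) ∧ (hpol f = 1 ↔ ∃ p : X, IsWanderingPoint f p) := by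
  have h1 : (∃ p : X, IsWanderingPoint f p) → hpol f = 1 := fun ⟨p, hp⟩ =>
    le_antisymm (hX.hpol_le_one hf) (one_le_hpol_of_isWanderingPoint hf hp)
  have h0 : (¬ ∃ p : X, IsWanderingPoint f p) → hpol f = 0 := by
    intro hne
    set g : X ≃ₜ X := hf.homeomorph f
    have hgf : ∀ n x, (g ^ n) x = f^[n] x := fun n x => congrFun (g.coe_pow_eq_iterate n) x
    have hg : g.Nonwandering := by
      rintro U hU ⟨p, hp⟩
      by_contra! hw
      refine hne ⟨p, U, hU, hp, fun n hn => eq_empty_iff_forall_notMem.2 ?_⟩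
      rintro _ ⟨⟨x, hx, rfl⟩, hx'⟩
      exact hw n hn x hx (by rwa [hgf])
    refine hpol_eq_zero_of_equicontinuous fun ε hε => ?_
    simpa only [hgf] using hg.equicontinuous hX hε
  by_cases hw : ∃ p : X, IsWanderingPoint f p
  · exact ⟨Or.inr (h1 hw), fun _ => hw, h1⟩
  · exact ⟨Or.inl (h0 hw), fun h => absurd (h.symm.trans (h0 hw)) one_ne_zero, fun h => (hw h).elim⟩
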